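/- arXiv:1806.07579 — 4 statements merged into one kernel-verified Lean document; each statement's English description precedes it below -/
import Mathlib

section
/- For every integer r with 0 ≤ r ≤ 2t, the number N_r of r-tuples (x_1, …, x_r) ∈ (F_{q²}^*)^r satisfying x_1^{d_j} + x_2^{d_j} + ⋯ + x_r^{d_j} = 0 simultaneously for all 0 ≤ j ≤ t is given by: N_0 = 1, N_1 = 0, and for r ≥ 2, N_r = r!·e^r·Σ_λ C((q+1)/e, L)·L!·Π_{j≥2} (B_j/j!)^{λ_j}/(λ_j)!, where the sum is over all tuples of nonnegative integers λ = (λ_2, λ_3, …) with Σ_{j≥2} j·λ_j = r, L = Σ_{j≥2} λ_j, B_j = q^{−1}(q−1)^j + (−1)^j(1 − q^{−1}), and C(·,·) is the binomial coefficient. -/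
theorem card_units_sum_eq_zero_fin {F : Type*} [Field F] [Finite F] (K : AddSubgroup F)
    (A : Subgroup Fˣ) (hKA : ∀ u : Fˣ, (u : F) ∈ K ↔ u ∈ A) (q : ℕ) (hA : Nat.card A + 1 = q)
    (k : ℕ) :
    (Nat.card {a : Fin k → A // ∑ i, ((a i : Fˣ) : F) = 0} : ℚ) =
      ((q : ℚ) - 1) ^ k / q + (-1) ^ k * (1 - 1 / q) := by
  have hq0 : (q : ℚ) ≠ 0 := by
    rw [← hA]; positivity
  induction k with
  | zero => simp
  | succ k ih =>
    have hK (a : Fin k → A) : ∑ i, ((a i : Fˣ) : F) ∈ K :=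
      sum_mem fun i _ ↦ (hKA _).2 (a i).2
    let E : {a : Fin (k + 1) → A // ∑ i, ((a i : Fˣ) : F) = 0} ≃
        {a : Fin k → A // ¬ ∑ i, ((a i : Fˣ) : F) = 0} :=
      { toFun := fun a ↦ ⟨Fin.tail a.1, fun h0 ↦ by
          have := a.2
          rw [Fin.sum_univ_succ] at this
          simp only [Fin.tail] at h0
          rw [h0, add_zero] at this
          exact (a.1 0 : Fˣ).ne_zero this⟩
        invFun := fun a ↦ ⟨Fin.cons ⟨Units.mk0 _ (neg_ne_zero.2 a.2),
            (hKA _).1 (K.neg_mem (hK a.1))⟩ a.1, by simp [Fin.sum_univ_succ]⟩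
        left_inv := fun a ↦ by
          have := a.2
          rw [Fin.sum_univ_succ, add_eq_zero_iff_eq_neg] at this
          ext i
          refine Fin.cases ?_ (fun i ↦ ?_) i
          · simp [this, Fin.tail]
          · simp [Fin.tail]
        right_inv := fun a ↦ by
          ext i
          simp [Fin.tail] }
    classical
    have hsum := Nat.card_congr
      (Equiv.sumCompl fun a : Fin k → A ↦ ∑ i, ((a i : Fˣ) : F) = 0)
    rw [Nat.card_sum, ← Nat.card_congr E, Nat.card_fun, Nat.card_eq_fintype_card (α := Fin k),
      Fintype.card_fin] at hsum
    have hsum' := congrArg (Nat.cast : ℕ → ℚ) hsum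
    have hA' : (Nat.card A : ℚ) = q - 1 := by rw [← hA]; simp
    rw [Nat.cast_add, ih, Nat.cast_pow, hA'] at hsum'
    rw [← eq_sub_iff_add_eq'] at hsum'
    rw [hsum']
    field_simp
    ring

theorem card_units_sum_eq_zero {F : Type*} [Field F] [Finite F] (K : AddSubgroup F)
    (A : Subgroup Fˣ) (hKA : ∀ u : Fˣ, (u : F) ∈ K ↔ u ∈ A) (q : ℕ) (hA : Nat.card A + 1 = q)
    (ι : Type*) [Fintype ι] :
    (Nat.card {a : ι → A // ∑ i, ((a i : Fˣ) : F) = 0} : ℚ) =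
      ((q : ℚ) - 1) ^ Fintype.card ι / q + (-1) ^ Fintype.card ι * (1 - 1 / q) := by
  rw [← card_units_sum_eq_zero_fin K A hKA q hA]
  congr 1
  refine Nat.card_congr ((Equiv.arrowCongr (Fintype.equivFin ι) (Equiv.refl A)).subtypeEquiv
    fun a ↦ ?_)
  rw [← Equiv.sum_comp (Fintype.equivFin ι)]
  simp

open Finset in
theorem sum_apply_card_fiber {ι J : Type*} [Fintype ι] [DecidableEq ι] [Fintype J] [DecidableEq J]
    (G : (J → ℕ) → ℚ) :
    ∑ w : ι → J, G (fun j ↦ #{i | w i = j}) =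
      ∑ k ∈ piAntidiag univ (Fintype.card ι), (Nat.multinomial univ k : ℚ) * G k := by
  classical
  let L : MvPolynomial J ℚ →ₗ[ℚ] ℚ := (MvPolynomial.basisMonomials J ℚ).constr ℚ fun k ↦ G k
  have hL (k : J → ℕ) : L (∏ j, MvPolynomial.X j ^ k j) = G k := by
    have : (∏ j, MvPolynomial.X j ^ k j : MvPolynomial J ℚ) =
        MvPolynomial.basisMonomials J ℚ (Finsupp.equivFunOnFinite.symm k) := by
      rw [MvPolynomial.coe_basisMonomials]
      beta_reduce
      rw [MvPolynomial.monomial_eq]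
      simp [Finsupp.prod_fintype]
    rw [this, Module.Basis.constr_basis]
    rfl
  have key : ∑ w : ι → J, ∏ i, (MvPolynomial.X (w i) : MvPolynomial J ℚ) =
      (∑ j, MvPolynomial.X j) ^ Fintype.card ι := by
    rw [← Finset.card_univ, ← prod_const, prod_univ_sum]
    simp
  rw [sum_pow_eq_sum_piAntidiag] at key
  have key' := congrArg L key
  rw [map_sum, map_sum] at key'
  calc _ = _ := sum_congr rfl fun w _ ↦ by
        rw [← hL, ← prod_fiberwise' univ w]
        simp only [prod_const]
    _ = _ := key'
    _ = _ := sum_congr rfl fun k _ ↦ by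
        rw [← nsmul_eq_mul, map_nsmul, hL, nsmul_eq_mul]

open Finset in
theorem sum_prod_card_fiber {r : ℕ} {V : Type*} [Fintype V] [DecidableEq V] (f : ℕ → ℚ) :
    ∑ w : Fin r → V, ∏ v, f #{i | w i = v} =
      r.factorial * ∑ k ∈ piAntidiag (univ : Finset (Fin (r + 1))) (Fintype.card V)
        with ∑ j : Fin (r + 1), (j : ℕ) * k j = r,
        (Nat.multinomial univ k : ℚ) * ∏ j : Fin (r + 1), (f j / (j : ℕ).factorial) ^ k j := by
  classical
  rw [sum_apply_card_fiber fun k : V → ℕ ↦ ∏ v, f (k v), sum_filter]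
  simp_rw [← mul_ite_zero]
  rw [← sum_apply_card_fiber (ι := V) fun k : Fin (r + 1) → ℕ ↦ if ∑ j : Fin (r + 1), (j : ℕ) * k j = r then
    ∏ j : Fin (r + 1), (f j / (j : ℕ).factorial) ^ k j else 0, Fintype.card_fin, mul_sum]
  have h1 (k : V → Fin (r + 1)) : ∑ j : Fin (r + 1), (j : ℕ) * #{v | k v = j} = ∑ v, (k v : ℕ) := by
    rw [← sum_fiberwise' univ k (fun j ↦ (j : ℕ))]
    simp [mul_comm]
  have h2 (k : V → Fin (r + 1)) : ∏ j : Fin (r + 1), (f j / (j : ℕ).factorial) ^ #{v | k v = j} =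
      ∏ v, (f (k v) / (k v : ℕ).factorial) := by
    rw [← prod_fiberwise' univ k (fun j ↦ (f j / (j : ℕ).factorial))]
    simp only [prod_const]
  simp_rw [h1, h2, mul_ite_zero]
  rw [← sum_filter]
  symm
  refine sum_bij (fun k _ v ↦ (k v : ℕ)) ?_ ?_ ?_ ?_
  · simp
  · intro k _ l _ hkl
    funext v
    exact Fin.ext (congrFun hkl v)
  · intro k hk
    have hk' : ∑ v, k v = r := by simpa using hk
    have hle (v : V) : k v < r + 1 :=
      Nat.lt_succ_of_le (hk' ▸ single_le_sum (fun _ _ ↦ Nat.zero_le _) (mem_univ v))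
    exact ⟨fun v ↦ ⟨k v, hle v⟩, by simpa using hk', rfl⟩
  · intro k hk
    have hk' : ∑ v, (k v : ℕ) = r := by simpa using hk
    have hs := Nat.multinomial_spec univ (fun v ↦ (k v : ℕ))
    rw [hk'] at hs
    rw [← hs, prod_div_distrib]
    push_cast
    have : (∏ v, ((k v : ℕ).factorial : ℚ)) ≠ 0 :=
      prod_ne_zero_iff.2 fun v _ ↦ by positivity
    field_simp

open Finset in
theorem sum_multinomial_eq_sum_choose (n r : ℕ) (c : ℕ → ℚ) (hc0 : c 0 = 1) (hc1 : c 1 = 0) :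
    ∑ k ∈ piAntidiag (univ : Finset (Fin (r + 1))) n with ∑ j : Fin (r + 1), (j : ℕ) * k j = r,
        (Nat.multinomial univ k : ℚ) * ∏ j : Fin (r + 1), c j ^ k j =
      ∑ fl ∈ univ.filter (fun fl : Fin (r + 1) → Fin (r + 1) =>
            (∀ j : Fin (r + 1), (j : ℕ) < 2 → fl j = 0) ∧
            ∑ j : Fin (r + 1), (j : ℕ) * (fl j : ℕ) = r),
          (n.choose (∑ j, (fl j : ℕ)) : ℚ) * ((∑ j, (fl j : ℕ)).factorial : ℚ) *
            ∏ j : Fin (r + 1), c j ^ (fl j : ℕ) / ((fl j : ℕ).factorial : ℚ) := by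
  symm
  have hsucc (g : Fin (r + 1) → ℕ) :
      ∑ j : Fin (r + 1), (j : ℕ) * g j = ∑ j : Fin r, ((j : ℕ) + 1) * g j.succ := by
    rw [Fin.sum_univ_succ]; simp
  have hle (fl : Fin (r + 1) → Fin (r + 1))
      (hne : (n.choose (∑ j, (fl j : ℕ)) : ℚ) * ((∑ j, (fl j : ℕ)).factorial : ℚ) *
            ∏ j : Fin (r + 1), c j ^ (fl j : ℕ) / ((fl j : ℕ).factorial : ℚ) ≠ 0) :
      ∑ j, (fl j : ℕ) ≤ n := by
    by_contra! hlt
    simp [Nat.choose_eq_zero_of_lt hlt] at hne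
  have hval (fl : Fin (r + 1) → Fin (r + 1)) (h0 : fl 0 = 0) (hle : ∑ j, (fl j : ℕ) ≤ n)
      (k : Fin (r + 1) → ℕ) (hk0 : k 0 = n - ∑ j, (fl j : ℕ))
      (hk : ∀ j : Fin r, k j.succ = fl j.succ) :
      (n.choose (∑ j, (fl j : ℕ)) : ℚ) * ((∑ j, (fl j : ℕ)).factorial : ℚ) *
        ∏ j : Fin (r + 1), c j ^ (fl j : ℕ) / ((fl j : ℕ).factorial : ℚ) =
      (Nat.multinomial univ k : ℚ) * ∏ j : Fin (r + 1), c j ^ k j := by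
    have hsum : ∑ j, k j = n := by
      rw [Fin.sum_univ_succ, h0] at hle hk0
      rw [Fin.sum_univ_succ, hk0]
      simp only [hk]
      simp at hle ⊢
      omega
    have hs := congrArg (Nat.cast : ℕ → ℚ) (Nat.multinomial_spec univ k)
    rw [hsum, Fin.prod_univ_succ, hk0, ← Nat.choose_mul_factorial_mul_factorial hle] at hs
    simp only [hk] at hs
    push_cast at hs
    rw [Fin.prod_univ_succ, Fin.prod_univ_succ, h0]
    simp only [hk, prod_div_distrib]
    have hp : (∏ j : Fin r, ((fl j.succ : ℕ).factorial : ℚ)) ≠ 0 :=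
      prod_ne_zero_iff.2 fun v _ ↦ by positivity
    have hf : ((n - ∑ j, (fl j : ℕ)).factorial : ℚ) ≠ 0 := by positivity
    simp [hc0]
    field_simp
    apply mul_left_cancel₀ hf
    linear_combination (-(∏ j : Fin r, c (j + 1) ^ (fl j.succ : ℕ))) * hs
  refine sum_bij_ne_zero
    (fun fl _ _ ↦ Fin.cons (n - ∑ j, (fl j : ℕ)) fun j ↦ (fl j.succ : ℕ)) ?_ ?_ ?_ ?_
  · intro fl hfl hne
    rw [mem_filter_univ] at hfl
    have hle := hle fl hne
    have h0 : fl 0 = 0 := hfl.1 0 (by simp)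
    have h2 := hfl.2
    rw [hsucc] at h2
    rw [mem_filter, mem_piAntidiag, hsucc]
    rw [Fin.sum_univ_succ, h0] at hle
    simp only [Fin.sum_univ_succ (n := r), h0]
    simp at hle ⊢
    omega
  · intro fl hfl _ gl hgl _ heq
    rw [mem_filter_univ] at hfl hgl
    funext j
    refine Fin.cases ?_ (fun j ↦ ?_) j
    · rw [hfl.1 0 (by simp), hgl.1 0 (by simp)]
    · exact Fin.ext (by simpa using congrFun heq j.succ)
  · intro k hk hne
    rw [mem_filter, mem_piAntidiag] at hk
    obtain ⟨⟨hkn, -⟩, hkr⟩ := hk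
    have hk1 (j : Fin (r + 1)) (hj : (j : ℕ) = 1) : k j = 0 := by
      by_contra hkj
      exact hne (mul_eq_zero_of_right _ (prod_eq_zero (mem_univ j) (by simp [hj, hc1, hkj])))
    have hkle (j : Fin (r + 1)) (hj : (j : ℕ) ≠ 0) : k j < r + 1 := by
      have h1 : (j : ℕ) * k j ≤ r :=
        (single_le_sum (f := fun j : Fin (r + 1) ↦ (j : ℕ) * k j)
          (fun _ _ ↦ Nat.zero_le _) (mem_univ j)).trans_eq hkr
      have h2 : k j ≤ j * k j := Nat.le_mul_of_pos_left _ (by omega)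
      omega
    let fl : Fin (r + 1) → Fin (r + 1) := fun j ↦ if h : (j : ℕ) = 0 then 0 else ⟨k j, hkle j h⟩
    have h0 : fl 0 = 0 := by simp [fl]
    have hfs (j : Fin r) : k j.succ = fl j.succ := by simp [fl]
    have hsum : ∑ j, (fl j : ℕ) = ∑ j : Fin r, k j.succ := by
      rw [Fin.sum_univ_succ, h0]
      simp [hfs]
    rw [Fin.sum_univ_succ] at hkn
    have hk0 : k 0 = n - ∑ j, (fl j : ℕ) := by omega
    refine ⟨fl, ?_, ?_, ?_⟩
    · rw [mem_filter_univ]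
      refine ⟨fun j hj ↦ ?_, ?_⟩
      · by_cases hj0 : (j : ℕ) = 0
        · exact dif_pos hj0
        · simp [fl, hk1 j (by omega)]
      · refine Eq.trans ?_ hkr
        rw [hsucc, hsucc]
        simp [hfs]
    · rwa [hval fl h0 (by omega) k hk0 hfs]
    · funext j
      refine Fin.cases ?_ (fun j ↦ ?_) j
      · simp [hk0]
      · simp [hfs]
  · intro fl hfl hne
    rw [mem_filter_univ] at hfl
    exact hval fl (hfl.1 0 (by simp)) (hle fl hne) _ rfl fun _ ↦ rfl

open Finset Polynomial in
theorem forall_sum_mul_pow_eq_zero_iff {F ι : Type*} [Field F] [DecidableEq F] [Fintype ι]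
    (φ : F →+* F) (a w : ι → F) (ha : ∀ i, φ (a i) = a i) (hw0 : ∀ i, w i ≠ 0)
    (hw : ∀ i, φ (w i) = (w i)⁻¹) (t : ℕ) (ht : Fintype.card ι ≤ 2 * t) :
    (∀ j ≤ t, ∑ i, a i * w i ^ j = 0) ↔ ∀ v, ∑ i with w i = v, a i = 0 := by
  constructor
  · intro H v
    have hinv (j : ℕ) (hj : j ≤ t) : ∑ i, a i * (w i)⁻¹ ^ j = 0 := by
      simpa [map_sum, ha, hw] using congrArg φ (H j hj)
    have hshift (j : ℕ) (hj : j < 2 * t + 1) : ∑ i, a i * (w i)⁻¹ ^ t * w i ^ j = 0 := by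
      rcases le_total j t with hjt | hjt
      · rw [← hinv (t - j) (by omega)]
        refine sum_congr rfl fun i _ ↦ ?_
        obtain ⟨k, rfl⟩ := Nat.exists_eq_add_of_le hjt
        have := hw0 i
        rw [Nat.add_sub_cancel_left]
        rw [pow_add, mul_assoc, mul_right_comm, ← mul_pow, inv_mul_cancel₀ this, one_pow, one_mul]
      · rw [← H (j - t) (by omega)]
        refine sum_congr rfl fun i _ ↦ ?_
        obtain ⟨k, rfl⟩ := Nat.exists_eq_add_of_le hjt
        have := hw0 i
        rw [Nat.add_sub_cancel_left]
        rw [pow_add, mul_assoc, ← mul_assoc _ (w i ^ t), ← mul_pow, inv_mul_cancel₀ this, one_pow,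
          one_mul]
    have hpoly (p : F[X]) (hp : p.natDegree < 2 * t + 1) :
        ∑ i, a i * (w i)⁻¹ ^ t * p.eval (w i) = 0 := by
      simp_rw [eval_eq_sum_range' hp, mul_sum]
      rw [sum_comm]
      refine sum_eq_zero fun j hj ↦ ?_
      rw [← mul_zero (p.coeff j), ← hshift j (mem_range.1 hj), mul_sum]
      exact sum_congr rfl fun i _ ↦ by ring
    by_cases hv : v ∈ univ.image w
    · let p : F[X] := ∏ u ∈ (univ.image w).erase v, (X - C u)
      have hp : p.natDegree < 2 * t + 1 := by
        rw [natDegree_finsetProd_X_sub_C_eq_card]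
        exact Nat.lt_succ_of_le ((card_erase_le.trans card_image_le).trans ht)
      have hpv : p.eval v ≠ 0 := by
        rw [eval_prod, prod_ne_zero_iff]
        intro u hu
        simpa [sub_eq_zero] using (ne_of_mem_erase hu).symm
      have hv0 : v ≠ 0 := by
        obtain ⟨i, -, rfl⟩ := mem_image.1 hv
        exact hw0 i
      have h := hpoly p hp
      rw [← sum_filter_add_sum_filter_not univ (fun i ↦ w i = v),
        sum_eq_zero (s := univ.filter fun i ↦ ¬ w i = v), add_zero] at h
      · rw [sum_congr rfl (g := fun i ↦ a i * (v⁻¹ ^ t * p.eval v)), ← sum_mul] at h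
        · exact (mul_eq_zero.1 h).resolve_right (mul_ne_zero (pow_ne_zero _ (inv_ne_zero hv0)) hpv)
        · intro i hi
          rw [(mem_filter.1 hi).2, mul_assoc]
      · intro i hi
        rw [eval_prod, prod_eq_zero (i := w i), mul_zero]
        · exact mem_erase.2 ⟨(mem_filter.1 hi).2, mem_image_of_mem w (mem_univ i)⟩
        · simp
    · refine sum_eq_zero fun i hi ↦ absurd ?_ hv
      rw [← (mem_filter.1 hi).2]
      exact mem_image_of_mem w (mem_univ i)
  · intro H j _
    rw [← sum_fiberwise_of_maps_to (fun i hi ↦ mem_image_of_mem w hi)]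
    refine sum_eq_zero fun v _ ↦ ?_
    rw [sum_congr rfl (g := fun i ↦ a i * v ^ j), ← sum_mul, H v, zero_mul]
    intro i hi
    rw [(mem_filter.1 hi).2]

open Finset in
theorem card_subtype_comp_of_card_fiber_eq {X Y ι : Type*} [Fintype ι] [Finite X] [Finite Y]
    (f : X → Y) (e : ℕ) (hf : ∀ y, Nat.card {x // f x = y} = e) (P : (ι → Y) → Prop) :
    Nat.card {x : ι → X // P (f ∘ x)} = e ^ Fintype.card ι * Nat.card {y : ι → Y // P y} := by
  classical
  have := Fintype.ofFinite X
  have := Fintype.ofFinite Y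
  simp only [Nat.card_eq_fintype_card, Fintype.card_subtype] at hf ⊢
  rw [card_eq_sum_card_fiberwise (f := fun x : ι → X ↦ f ∘ x) (t := univ.filter P)
    fun x hx ↦ by simpa using hx]
  rw [sum_congr rfl (g := fun _ ↦ e ^ Fintype.card ι), sum_const, smul_eq_mul, mul_comm]
  intro y hy
  have : ({x ∈ univ.filter fun x : ι → X ↦ P (f ∘ x) | f ∘ x = y} : Finset (ι → X)) =
      Fintype.piFinset fun i ↦ {x | f x = y i} := by
    ext x
    simp only [mem_filter, mem_univ, true_and, Fintype.mem_piFinset, funext_iff,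
      Function.comp_apply]
    refine ⟨fun h ↦ h.2, fun h ↦ ⟨?_, h⟩⟩
    rw [show f ∘ x = y from funext h]
    simpa using hy
  rw [this, Fintype.card_piFinset, prod_congr rfl fun i _ ↦ hf (y i)]
  simp

open Finset in
theorem card_pairs_fiber_sum_eq_zero {F A V ι : Type*} [AddCommMonoid F] [Finite A] [Fintype V]
    [DecidableEq V] [Fintype ι] [DecidableEq ι] (c : A → F) :
    Nat.card {y : ι → A × V // ∀ v, ∑ i with (y i).2 = v, c (y i).1 = 0} =
      ∑ w : ι → V, ∏ v, Nat.card {a : {i // w i = v} → A // ∑ i, c (a i) = 0} := by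
  let E₁ : {y : ι → A × V // ∀ v, ∑ i with (y i).2 = v, c (y i).1 = 0} ≃
      Σ w : ι → V, {a : ι → A // ∀ v, ∑ i with w i = v, c (a i) = 0} :=
    { toFun := fun y ↦ ⟨fun i ↦ (y.1 i).2, fun i ↦ (y.1 i).1, y.2⟩
      invFun := fun y ↦ ⟨fun i ↦ (y.2.1 i, y.1 i), y.2.2⟩
      left_inv := fun _ ↦ rfl
      right_inv := fun _ ↦ rfl }
  let E₂ (w : ι → V) : {a : ι → A // ∀ v, ∑ i with w i = v, c (a i) = 0} ≃
      ∀ v, {a : {i // w i = v} → A // ∑ i, c (a i) = 0} :=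
    { toFun := fun a v ↦ ⟨fun i ↦ a.1 i, by
        exact (sum_subtype _ (by simp) fun i ↦ c (a.1 i)).symm.trans (a.2 v)⟩
      invFun := fun b ↦ ⟨fun i ↦ (b (w i)).1 ⟨i, rfl⟩, fun v ↦ by
        refine Eq.trans ?_ (b v).2
        rw [sum_subtype (p := fun i ↦ w i = v) _ (by simp)]
        refine sum_congr rfl ?_
        rintro ⟨i, rfl⟩ _
        rfl⟩
      left_inv := fun _ ↦ rfl
      right_inv := fun b ↦ by
        ext v ⟨i, rfl⟩
        rfl }
  rw [Nat.card_congr E₁, Nat.card_sigma]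
  exact sum_congr rfl fun w _ ↦ by rw [Nat.card_congr (E₂ w), Nat.card_pi]

theorem exists_monoidHom_ker_prod_ker {G : Type*} [CommGroup G] [IsCyclic G] [Finite G]
    (q n e h d : ℕ) (hq : 2 ≤ q) (hG : Nat.card G = (q - 1) * (q + 1)) (hd : q + 1 ∣ d)
    (hdq : d.Coprime (q - 1)) (he : e = h.gcd (q + 1)) (hn : q + 1 = n * e) :
    ∃ f : G →* (powMonoidHom (q - 1) : G →* G).ker × (powMonoidHom n : G →* G).ker,
      (∀ x, ((f x).1 : G) = x ^ d ∧ ((f x).2 : G) = x ^ (h * (q - 1))) ∧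
      ∀ y, Nat.card {x // f x = y} = e := by
  have heh : e ∣ h := he ▸ Nat.gcd_dvd_left _ _
  have heq : e ∣ q + 1 := ⟨n, by rw [hn, mul_comm]⟩
  have hpow (x : G) (k : ℕ) (hk : (q - 1) * (q + 1) ∣ k) : x ^ k = 1 :=
    orderOf_dvd_iff_pow_eq_one.1 (((orderOf_dvd_natCard x).trans hG.dvd).trans hk)
  let f₁ : G →* (powMonoidHom (q - 1) : G →* G).ker := (powMonoidHom d).codRestrict _ fun x ↦ by
    rw [MonoidHom.mem_ker, powMonoidHom_apply, powMonoidHom_apply, ← pow_mul]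
    exact hpow x _ (by rw [mul_comm d]; exact mul_dvd_mul_left _ hd)
  let f₂ : G →* (powMonoidHom n : G →* G).ker :=
    (powMonoidHom (h * (q - 1))).codRestrict _ fun x ↦ by
      rw [MonoidHom.mem_ker, powMonoidHom_apply, powMonoidHom_apply, ← pow_mul]
      refine hpow x _ ?_
      obtain ⟨k, rfl⟩ := heh
      exact ⟨k, by rw [hn]; ring⟩
  have hker : (f₁.prod f₂).ker = (powMonoidHom e : G →* G).ker := by
    ext x
    have h₁ : f₁ x = 1 ↔ x ^ d = 1 := Subtype.ext_iff
    have h₂ : f₂ x = 1 ↔ x ^ (h * (q - 1)) = 1 := Subtype.ext_iff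
    rw [MonoidHom.mem_ker, MonoidHom.mem_ker, MonoidHom.prod_apply, Prod.mk_eq_one, h₁, h₂,
      powMonoidHom_apply]
    simp only [← orderOf_dvd_iff_pow_eq_one]
    constructor
    · rintro ⟨hx₁, hx₂⟩
      have hx₃ : orderOf x ∣ (q - 1) * (q + 1) := hG ▸ orderOf_dvd_natCard x
      have hx₄ : orderOf x ∣ e * (q - 1) := by
        rw [he, ← Nat.gcd_mul_right]
        exact Nat.dvd_gcd hx₂ (by rwa [mul_comm])
      exact (Nat.Coprime.of_dvd_left hx₁ hdq).dvd_of_dvd_mul_right hx₄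
    · intro hx
      exact ⟨hx.trans (heq.trans hd), (hx.trans heh).trans (dvd_mul_right _ _)⟩
  have hq1 : 0 < q - 1 := by omega
  have he0 : 0 < e := Nat.pos_of_dvd_of_pos heq (by omega)
  have hcardker : Nat.card (f₁.prod f₂).ker = e := by
    rw [hker, IsCyclic.card_powMonoidHom_ker, hG]
    exact Nat.gcd_eq_right (heq.trans (dvd_mul_left _ _))
  have hcard : Nat.card ((powMonoidHom (q - 1) : G →* G).ker × (powMonoidHom n : G →* G).ker) =
      (q - 1) * n := by
    rw [Nat.card_prod, IsCyclic.card_powMonoidHom_ker, IsCyclic.card_powMonoidHom_ker, hG,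
      Nat.gcd_eq_right (dvd_mul_right _ _),
      Nat.gcd_eq_right ((Dvd.intro _ hn.symm).trans (dvd_mul_left _ _))]
  have hsurj : Function.Surjective (f₁.prod f₂) := by
    rw [← MonoidHom.range_eq_top]
    apply Subgroup.eq_top_of_card_eq
    rw [hcard]
    have := (f₁.prod f₂).ker.card_mul_index
    rw [hcardker, Subgroup.index_ker, hG, hn] at this
    exact Nat.eq_of_mul_eq_mul_left he0 (by rw [this]; ring)
  exact ⟨f₁.prod f₂, fun x ↦ ⟨rfl, rfl⟩, fun y ↦
    (Nat.card_congr (MonoidHom.fiberEquivKerOfSurjective hsurj y)).trans hcardker⟩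

theorem niho_exponent_modEq (q h Δ : ℕ) (hq : Even q) (s₀ s : ℤ) (d₀ d j : ℕ)
    (hs₀ : 2 * s₀ ≡ Δ [ZMOD ((q : ℤ) + 1)])
    (hs : 2 * s ≡ 2 * (j : ℤ) * h + Δ [ZMOD ((q : ℤ) + 1)])
    (hd₀ : (d₀ : ℤ) ≡ s₀ * ((q : ℤ) - 1) + Δ [ZMOD ((q : ℤ) ^ 2 - 1)])
    (hd : (d : ℤ) ≡ s * ((q : ℤ) - 1) + Δ [ZMOD ((q : ℤ) ^ 2 - 1)]) :
    ((q : ℤ) - 1) * (q + 1) ∣ (d : ℤ) - (d₀ + h * ((q : ℤ) - 1) * j) := by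
  have h2 : IsCoprime ((q : ℤ) + 1) 2 := by
    obtain ⟨k, hk⟩ := hq
    exact ⟨1, -k, by rw [hk]; push_cast; ring⟩
  have hs' : (q : ℤ) + 1 ∣ s - s₀ - j * h := by
    refine h2.dvd_of_dvd_mul_left ?_
    have := dvd_sub hs.symm.dvd hs₀.symm.dvd
    exact this.trans (dvd_of_eq (by ring))
  have := dvd_add (dvd_sub hd.symm.dvd hd₀.symm.dvd)
    (show (q : ℤ) ^ 2 - 1 ∣ ((q : ℤ) - 1) * (s - s₀ - j * h) by
      rw [show (q : ℤ) ^ 2 - 1 = ((q : ℤ) - 1) * (q + 1) by ring]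
      exact mul_dvd_mul_left _ hs')
  rw [show (q : ℤ) ^ 2 - 1 = ((q : ℤ) - 1) * (q + 1) by ring] at this
  exact this.trans (dvd_of_eq (by ring))

theorem niho_base_exponent (q Δ : ℕ) (hq : 1 ≤ q) (s : ℤ) (d : ℕ) (hΔ : Nat.gcd Δ (q - 1) = 1)
    (hs : 2 * s ≡ Δ [ZMOD ((q : ℤ) + 1)])
    (hd : (d : ℤ) ≡ s * ((q : ℤ) - 1) + Δ [ZMOD ((q : ℤ) ^ 2 - 1)]) :
    q + 1 ∣ d ∧ d.Coprime (q - 1) := by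
  have hfac : (q : ℤ) ^ 2 - 1 = ((q : ℤ) - 1) * (q + 1) := by ring
  have hd' := hd.symm.dvd
  rw [hfac] at hd'
  constructor
  · have h₁ := (dvd_mul_left _ _).trans hd'
    have h₂ := hs.dvd
    zify
    have := dvd_add (dvd_add h₁ h₂) (dvd_mul_left ((q : ℤ) + 1) s)
    exact this.trans (dvd_of_eq (by ring))
  · have h₁ : ((q - 1 : ℕ) : ℤ) ∣ d - Δ := by
      push_cast [hq]
      have := dvd_add ((dvd_mul_right _ _).trans hd') (dvd_mul_left ((q : ℤ) - 1) s)
      exact this.trans (dvd_of_eq (by ring))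
    have h₂ : Δ ≡ d [MOD (q - 1)] := (Nat.modEq_iff_dvd).2 h₁
    rw [Nat.coprime_iff_gcd_eq_one]
    exact h₂.symm.gcd_eq.trans hΔ


/-- Appendix I, case `C⁽¹⁾`: with `p = 2`, `q = 2^m`, `F` the field with `q²` elements and
Niho-type exponents `d_0, …, d_t` as in the paper, for `0 ≤ r ≤ 2t` the number `N_r` of
`r`-tuples `(x₁, …, x_r) ∈ (F_{q²}^*)^r` with `x₁^{d_j} + ⋯ + x_r^{d_j} = 0` for all
`0 ≤ j ≤ t` satisfies `N_0 = 1`, `N_1 = 0`, and for `r ≥ 2`,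
`N_r = r! e^r ∑_{λ : ∑_{j≥2} jλ_j = r} C((q+1)/e, L) L! ∏_j (B_j/j!)^{λ_j}/λ_j!` where
`L = ∑_j λ_j` and `B_j = q⁻¹(q-1)^j + (-1)^j(1-q⁻¹)`. -/
theorem stmt_11 (m : ℕ) (hm : 0 < m) (q : ℕ) (hq : q = 2 ^ m)
    (F : Type*) [Field F] [Fintype F] (hF : Fintype.card F = q ^ 2)
    (γ : Fˣ) (hγ : ∀ x : Fˣ, x ∈ Subgroup.zpowers γ)
    (h Δ : ℕ) (hh : 0 < h) (hΔpos : 0 < Δ)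
    (hhq : ¬ (q + 1) ∣ h) (hΔ : Nat.gcd Δ (q - 1) = 1)
    (e : ℕ) (he : e = Nat.gcd h (q + 1))
    (t : ℕ) (ht : 2 * e * t ≤ q + 1)
    (d : ℕ → ℕ) (s : ℕ → ℤ)
    (hdpos : ∀ j ≤ t, 0 < d j)
    (hs : ∀ j ≤ t, 2 * s j ≡ 2 * (j : ℤ) * h + Δ [ZMOD ((q : ℤ) + 1)])
    (hd : ∀ j ≤ t, (d j : ℤ) ≡ s j * ((q : ℤ) - 1) + Δ [ZMOD ((q : ℤ) ^ 2 - 1)])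
    (r : ℕ) (hr : r ≤ 2 * t)
    (N : ℕ)
    (hN : N = Nat.card {x : Fin r → Fˣ // ∀ j ≤ t, ∑ i, ((x i : F)) ^ d j = 0}) :
    (r = 0 → N = 1) ∧ (r = 1 → N = 0) ∧
    (2 ≤ r → (N : ℚ) =
      (r.factorial : ℚ) * (e : ℚ) ^ r *
        ∑ fl ∈ Finset.univ.filter (fun fl : Fin (r + 1) → Fin (r + 1) =>
            (∀ j : Fin (r + 1), (j : ℕ) < 2 → fl j = 0) ∧
            ∑ j : Fin (r + 1), (j : ℕ) * (fl j : ℕ) = r),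
          (((q + 1) / e).choose (∑ j, (fl j : ℕ)) : ℚ) *
            ((∑ j, (fl j : ℕ)).factorial : ℚ) *
            ∏ j : Fin (r + 1),
              ((((q : ℚ) - 1) ^ (j : ℕ) / q + (-1) ^ (j : ℕ) * (1 - 1 / q)) /
                  ((j : ℕ).factorial : ℚ)) ^ (fl j : ℕ) /
                ((fl j : ℕ).factorial : ℚ)) := by
  have hq2 : 2 ≤ q := by
    rw [hq]
    exact Nat.le_self_pow hm.ne' 2
  have hq_even : Even q := by
    rw [hq, Nat.even_pow]
    exact ⟨even_two, hm.ne'⟩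
  have hs₀ : 2 * s 0 ≡ Δ [ZMOD ((q : ℤ) + 1)] := by simpa using hs 0 (Nat.zero_le _)
  have hd₀ := hd 0 (Nat.zero_le _)
  obtain ⟨n, hn⟩ : e ∣ q + 1 := he ▸ Nat.gcd_dvd_right _ _
  rw [mul_comm] at hn
  have he0 : 0 < e := Nat.pos_of_ne_zero fun h0 ↦ by simp [h0] at hn
  have hcard : Nat.card Fˣ = (q - 1) * (q + 1) := by
    rw [Nat.card_units, Nat.card_eq_fintype_card, hF, mul_comm, ← Nat.sq_sub_sq, one_pow]
  obtain ⟨hqd, hdq⟩ := niho_base_exponent q Δ (by omega) (s 0) (d 0) hΔ hs₀ hd₀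
  have hexists := exists_monoidHom_ker_prod_ker q n e h (d 0) hq2 hcard hqd hdq he hn
  obtain ⟨A, hA⟩ : ∃ A, A = (powMonoidHom (q - 1) : Fˣ →* Fˣ).ker := ⟨_, rfl⟩
  obtain ⟨V, hV⟩ : ∃ V, V = (powMonoidHom n : Fˣ →* Fˣ).ker := ⟨_, rfl⟩
  rw [← hA, ← hV] at hexists
  obtain ⟨f, hf, hfib⟩ := hexists
  have hpow (x : Fˣ) (j : ℕ) (hj : j ≤ t) :
      (x : F) ^ d j = ((f x).1 : Fˣ) * (((f x).2 : Fˣ) : F) ^ j := by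
    rw [(hf x).1, (hf x).2]
    norm_cast
    rw [← pow_mul, ← pow_add, pow_eq_pow_iff_modEq]
    refine ((Nat.modEq_iff_dvd.2 ?_).of_dvd (orderOf_dvd_natCard x)).symm
    rw [hcard]
    have := niho_exponent_modEq q h Δ hq_even (s 0) (s j) (d 0) (d j) j hs₀ (hs j hj) hd₀ (hd j hj)
    push_cast [show 1 ≤ q by omega]
    exact this
  classical
  have : CharP F 2 := charP_of_card_eq_prime_pow (f := m * 2) (by rw [hF, hq, pow_mul])
  let φ : F →+* F := iterateFrobenius F 2 m
  have hφ (x : F) : φ x = x ^ q := by rw [hq]; exact iterateFrobenius_def 2 m x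
  let K : AddSubgroup F := (φ : F →+ F).eqLocus (AddMonoidHom.id F)
  have hKA (u : Fˣ) : (u : F) ∈ K ↔ u ∈ A := by
    rw [hA]
    change φ u = u ↔ u ^ (q - 1) = 1
    rw [hφ, ← Units.val_pow_eq_pow_val, Units.val_inj]
    obtain ⟨k, rfl⟩ : ∃ k, q = k + 1 := ⟨q - 1, by omega⟩
    rw [pow_succ, Nat.add_sub_cancel, mul_eq_right]
  have hcardA : Nat.card A + 1 = q := by
    rw [hA, IsCyclic.card_powMonoidHom_ker, hcard, Nat.gcd_eq_right (dvd_mul_right _ _)]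
    omega
  have hcardV : Nat.card V = n := by
    rw [hV, IsCyclic.card_powMonoidHom_ker, hcard,
      Nat.gcd_eq_right ((Dvd.intro _ hn.symm).trans (dvd_mul_left _ _))]
  have hφV (v : V) : φ ((v : Fˣ) : F) = (((v : Fˣ) : F))⁻¹ := by
    have hv : (v : Fˣ) ^ n = 1 := by simpa [hV] using v.2
    have hv' : (v : Fˣ) ^ (q + 1) = 1 := by rw [hn, pow_mul, hv, one_pow]
    rw [hφ]
    refine eq_inv_of_mul_eq_one_left ?_
    rw [← pow_succ]
    rw [← Units.val_pow_eq_pow_val, hv', Units.val_one]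
  have hiff (x : Fin r → Fˣ) : (∀ j ≤ t, ∑ i, ((x i : F)) ^ d j = 0) ↔
      ∀ v : V, ∑ i with ((f ∘ x) i).2 = v, ((((f ∘ x) i).1 : Fˣ) : F) = 0 := by
    have key := forall_sum_mul_pow_eq_zero_iff φ (fun i ↦ (((f (x i)).1 : Fˣ) : F))
      (fun i ↦ (((f (x i)).2 : Fˣ) : F)) (fun i ↦ (hKA _).2 (f (x i)).1.2)
      (fun i ↦ Units.ne_zero _) (fun i ↦ hφV _) t (by simpa using hr)
    have hL : (∀ j ≤ t, ∑ i, ((x i : F)) ^ d j = 0) ↔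
        ∀ j ≤ t, ∑ i, (((f (x i)).1 : Fˣ) : F) * (((f (x i)).2 : Fˣ) : F) ^ j = 0 :=
      forall₂_congr fun j hj ↦ by simp_rw [hpow _ j hj]
    rw [hL, key]
    constructor
    · intro H v
      rw [← H ((v : Fˣ) : F)]
      simp only [Function.comp_apply, Units.val_inj, Subtype.val_inj]
    · intro H v
      by_cases hv : ∃ v' : V, ((v' : Fˣ) : F) = v
      · obtain ⟨v', rfl⟩ := hv
        rw [← H v']
        simp only [Function.comp_apply, Units.val_inj, Subtype.val_inj]
      · rw [Finset.filter_false_of_mem fun i _ hi ↦ hv ⟨_, hi⟩, Finset.sum_empty]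
  refine ⟨?_, ?_, fun _ ↦ ?_⟩
  · rintro rfl
    simp [hN]
  · rintro rfl
    rw [hN, Nat.card_eq_zero]
    left
    refine ⟨fun x ↦ ?_⟩
    have := x.2 0 (Nat.zero_le _)
    simp at this
  · let B : ℕ → ℚ := fun j ↦ ((q : ℚ) - 1) ^ j / q + (-1) ^ j * (1 - 1 / q)
    have hqQ : (q : ℚ) ≠ 0 := by positivity
    have hB (w : Fin r → V) (v : V) :
        (Nat.card {a : {i // w i = v} → A // ∑ i, ((a i : Fˣ) : F) = 0} : ℚ) =
          B (Finset.card {i | w i = v}) := by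
      rw [card_units_sum_eq_zero K A hKA q hcardA, Fintype.card_subtype]
    have hNe : N = e ^ r * ∑ w : Fin r → V, ∏ v,
        Nat.card {a : {i // w i = v} → A // ∑ i, ((a i : Fˣ) : F) = 0} := by
      rw [hN, Nat.card_congr (Equiv.subtypeEquivRight hiff),
        card_subtype_comp_of_card_fiber_eq f e hfib fun y ↦
          ∀ v : V, ∑ i with (y i).2 = v, ((((y i).1 : Fˣ) : F)) = 0,
        card_pairs_fiber_sum_eq_zero fun a : A ↦ ((a : Fˣ) : F), Fintype.card_fin]
    rw [hNe]
    push_cast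
    simp_rw [hB]
    have hne : (q + 1) / e = n := by rw [hn, Nat.mul_div_cancel _ he0]
    rw [sum_prod_card_fiber, ← Nat.card_eq_fintype_card, hcardV,
      sum_multinomial_eq_sum_choose n r (fun j ↦ B j / j.factorial), hne]
    · ring
    · simp only [B]
      simp
    · simp only [B]
      field_simp
      simp
end

section
/- Let p = 2. For every integer r with 0 ≤ r ≤ 2t, the number N_r of r-tuples (x_1, …, x_r) ∈ (F_{q²}^*)^r satisfying x_1^{d̃_j} + x_2^{d̃_j} + ⋯ + x_r^{d̃_j} = 0 simultaneously for all 1 ≤ j ≤ t is given by: N_0 = 1, N_1 = 0, and for r ≥ 2, N_r = r!·e^r·Σ_λ C((q+1)/e, L)·L!·Π_{j≥2} (B_j/j!)^{λ_j}/(λ_j)!, where the sum is over all tuples of nonnegative integers λ = (λ_2, λ_3, …) with Σ_{j≥2} j·λ_j = r, L = Σ_{j≥2} λ_j, B_j = q^{−1}(q−1)^j + (−1)^j(1 − q^{−1}), and C(·,·) is the binomial coefficient. -/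
section

open Finset Polynomial

/-- The number of words with given letter multiplicities is a multinomial coefficient. -/
theorem sum_prod_fiber_card {C : Type*} [Fintype C] [DecidableEq C] (f : ℕ → ℚ) (r : ℕ) :
    ∑ c : Fin r → C, ∏ g, f #{i | c i = g} =
      ∑ k ∈ piAntidiag (univ : Finset C) r, (Nat.multinomial univ k : ℚ) * ∏ g, f (k g) := by
  have key : ∀ (k : C →₀ ℕ) (a : ℚ),
      (MvPolynomial.basisMonomials C ℚ).constr ℚ (fun k => ∏ g, f (k g))
        (MvPolynomial.monomial k a) = a * ∏ g, f (k g) := by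
    intro k a
    have : MvPolynomial.monomial k a = a • MvPolynomial.basisMonomials C ℚ k := by
      simp [MvPolynomial.smul_monomial]
    rw [this, map_smul, Module.Basis.constr_basis, smul_eq_mul]
  have expand : (∑ g : C, (MvPolynomial.X g : MvPolynomial C ℚ)) ^ r =
      ∑ c : Fin r → C, MvPolynomial.monomial (∑ i, Finsupp.single (c i) 1) 1 := by
    rw [Fintype.sum_pow]
    refine Finset.sum_congr rfl fun c _ => ?_
    rw [MvPolynomial.monomial_sum_one]
    rfl
  have expand' : (∑ g : C, (MvPolynomial.X g : MvPolynomial C ℚ)) ^ r =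
      ∑ k ∈ piAntidiag (univ : Finset C) r,
        MvPolynomial.monomial (Finsupp.equivFunOnFinite.symm k) (Nat.multinomial univ k : ℚ) := by
    rw [Finset.sum_pow_eq_sum_piAntidiag]
    refine Finset.sum_congr rfl fun k _ => ?_
    rw [MvPolynomial.monomial_eq, Finsupp.prod_fintype _ _ (by simp)]
    simp
  have := congrArg ((MvPolynomial.basisMonomials C ℚ).constr ℚ (fun k => ∏ g, f (k g)))
    (expand.symm.trans expand')
  rw [map_sum, map_sum] at this
  simp only [key, one_mul] at this
  convert this using 5 with c _ g _
  · rw [Finsupp.finsetSum_apply, Finset.card_filter]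
    simp only [Finsupp.single_apply]
  · rfl

theorem sum_prod_fiber_card_eq_coeff {C : Type*} [Fintype C] [DecidableEq C] (f : ℕ → ℚ) (r : ℕ) :
    ∑ c : Fin r → C, ∏ g, f #{i | c i = g} =
      r.factorial * coeff ((∑ j : Fin (r + 1), monomial (j : ℕ) (f j / (j : ℕ).factorial)) ^
        Fintype.card C) r := by
  rw [sum_prod_fiber_card, Fintype.card, ← Finset.prod_const, Finset.prod_univ_sum,
    finsetSum_coeff, Finset.mul_sum]
  have hmon : ∀ k : C → Fin (r + 1),
      ∏ g, monomial (k g : ℕ) (f (k g) / ((k g : ℕ).factorial : ℚ)) =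
        monomial (∑ g, (k g : ℕ)) (∏ g, f (k g) / ((k g : ℕ).factorial : ℚ)) := by
    intro k
    simp only [← C_mul_X_pow_eq_monomial, Finset.prod_mul_distrib, Finset.prod_pow_eq_pow_sum,
      map_prod]
  simp only [hmon, coeff_monomial, mul_ite, mul_zero]
  rw [← Finset.sum_filter]
  symm
  refine Finset.sum_bij (fun k _ g => (k g : ℕ)) ?_ ?_ ?_ ?_
  · intro k hk
    simpa using hk
  · intro k _ k' _ hkk
    ext g
    exact congrFun hkk g
  · intro k hk
    rw [mem_piAntidiag] at hk
    have hle : ∀ g, k g < r + 1 := fun g =>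
      Nat.lt_succ_of_le (hk.1 ▸ Finset.single_le_sum (f := k) (by simp) (mem_univ g))
    exact ⟨fun g => ⟨k g, hle g⟩, by simpa using hk.1, rfl⟩
  · intro k hk
    have hk : ∑ g, (k g : ℕ) = r := by simpa using hk
    have := Nat.multinomial_spec (univ : Finset C) (fun g => (k g : ℕ))
    rw [hk] at this
    rw [← this, Finset.prod_div_distrib]
    push_cast
    have : ∏ g, ((k g : ℕ).factorial : ℚ) ≠ 0 :=
      Finset.prod_ne_zero_iff.mpr fun g _ => by positivity
    field_simp

theorem coeff_sum_monomial_pow (b : ℕ → ℚ) (hb0 : b 0 = 1) (hb1 : b 1 = 0) (n r : ℕ) :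
    coeff ((∑ j : Fin (r + 1), monomial (j : ℕ) (b j)) ^ n) r =
      ∑ fl ∈ Finset.univ.filter (fun fl : Fin (r + 1) → Fin (r + 1) =>
            (∀ j : Fin (r + 1), (j : ℕ) < 2 → fl j = 0) ∧
            ∑ j : Fin (r + 1), (j : ℕ) * (fl j : ℕ) = r),
          (n.choose (∑ j, (fl j : ℕ)) : ℚ) * ((∑ j, (fl j : ℕ)).factorial : ℚ) *
            ∏ j : Fin (r + 1), b j ^ (fl j : ℕ) / ((fl j : ℕ).factorial : ℚ) := by
  have hcoeff : ∀ k : Fin (r + 1) → ℕ,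
      coeff ((Nat.multinomial univ k : ℚ[X]) *
          ∏ j : Fin (r + 1), monomial (j : ℕ) (b j) ^ k j) r =
        if ∑ j : Fin (r + 1), (j : ℕ) * k j = r then
          (Nat.multinomial univ k : ℚ) * ∏ j : Fin (r + 1), b j ^ k j else 0 := by
    intro k
    have hmon : ∏ j : Fin (r + 1), monomial (j : ℕ) (b j) ^ k j =
        monomial (∑ j : Fin (r + 1), (j : ℕ) * k j) (∏ j : Fin (r + 1), b j ^ k j) := by
      simp only [← C_mul_X_pow_eq_monomial, mul_pow, Finset.prod_mul_distrib, ← pow_mul,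
        Finset.prod_pow_eq_pow_sum, map_prod, map_pow]
    rw [hmon, ← C_eq_natCast, coeff_C_mul, coeff_monomial, mul_ite, mul_zero]
  rw [Finset.sum_pow_eq_sum_piAntidiag, finsetSum_coeff]
  simp only [hcoeff]
  rw [← Finset.sum_filter]
  have hzero : ∀ fl ∈ Finset.univ.filter (fun fl : Fin (r + 1) → Fin (r + 1) =>
      (∀ j : Fin (r + 1), (j : ℕ) < 2 → fl j = 0) ∧
        ∑ j : Fin (r + 1), (j : ℕ) * (fl j : ℕ) = r), fl 0 = 0 := by
    intro fl hfl
    exact (mem_filter.mp hfl).2.1 0 (by simp)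
  symm
  refine Finset.sum_bij_ne_zero
    (fun fl _ _ => (Fin.cons (n - ∑ j, (fl j : ℕ)) (fun j : Fin r => (fl j.succ : ℕ)) :
      Fin (r + 1) → ℕ)) ?_ ?_ ?_ ?_
  · intro fl hfl hne
    have hle : ∑ j, (fl j : ℕ) ≤ n := by
      by_contra! hlt
      exact hne (by simp [Nat.choose_eq_zero_of_lt hlt])
    have h0 := hzero fl hfl
    have h2 := (mem_filter.mp hfl).2.2
    rw [Fin.sum_univ_succ, h0] at hle
    rw [Fin.sum_univ_succ] at h2
    simp only [mem_filter, mem_piAntidiag, Fin.sum_univ_succ, Fin.cons_zero, Fin.cons_succ, h0]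
    simp at h2 hle ⊢
    exact ⟨by omega, h2⟩
  · intro fl hfl _ fl' hfl' _ heq
    ext j
    refine Fin.cases ?_ (fun j => ?_) j
    · rw [hzero fl hfl, hzero fl' hfl']
    · simpa using congrFun heq j.succ
  · intro k hk hne
    simp only [mem_filter, mem_piAntidiag] at hk
    have hprod : ∀ j : Fin (r + 1), b j ^ k j ≠ 0 := fun j =>
      Finset.prod_ne_zero_iff.mp (right_ne_zero_of_mul hne) j (mem_univ j)
    have hle : ∀ j : Fin r, k j.succ < r + 1 := by
      intro j
      have := Finset.single_le_sum (f := fun j : Fin (r + 1) => (j : ℕ) * k j)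
        (by simp) (mem_univ j.succ)
      rw [hk.2] at this
      simp only [Fin.val_succ] at this
      nlinarith
    have hsum : k 0 + ∑ j : Fin r, k j.succ = n := by rw [← Fin.sum_univ_succ]; exact hk.1.1
    refine ⟨Fin.cons 0 fun j => ⟨k j.succ, hle j⟩, ?_, ?_, ?_⟩
    · simp only [mem_filter, mem_univ, true_and]
      refine ⟨fun j => ?_, ?_⟩
      · refine Fin.cases (fun _ => rfl) (fun i hi => ?_) j
        have hi0 : ((i.succ : Fin (r + 1)) : ℕ) = 1 := by
          rw [Fin.val_succ] at hi ⊢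
          omega
        have := hprod i.succ
        rw [hi0, hb1] at this
        rw [Fin.cons_succ]
        ext
        by_contra hki
        exact this (zero_pow hki)
      · have := hk.2
        rw [Fin.sum_univ_succ] at this ⊢
        simpa using this
    · refine mul_ne_zero (mul_ne_zero ?_ (by positivity)) ?_
      · rw [Nat.cast_ne_zero, Nat.choose_ne_zero_iff, Fin.sum_univ_succ]
        simp
        omega
      · refine Finset.prod_ne_zero_iff.mpr fun j _ => div_ne_zero ?_ (by positivity)
        refine Fin.cases ?_ (fun i => ?_) j
        · simp
        · simpa using hprod i.succ
    · ext j
      refine Fin.cases ?_ (fun i => ?_) j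
      · rw [Fin.cons_zero, Fin.sum_univ_succ]
        simp
        omega
      · simp
  · intro fl hfl hne
    have hle : ∑ j, (fl j : ℕ) ≤ n := by
      by_contra! hlt
      exact hne (by simp [Nat.choose_eq_zero_of_lt hlt])
    have h0 := hzero fl hfl
    have hspec := Nat.multinomial_spec univ
      (Fin.cons (n - ∑ j, (fl j : ℕ)) (fun j : Fin r => (fl j.succ : ℕ)) : Fin (r + 1) → ℕ)
    have hchoose := Nat.choose_mul_factorial_mul_factorial hle
    rw [Fin.sum_cons, Fin.prod_univ_succ, Fin.cons_zero] at hspec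
    have hn : n - ∑ j, (fl j : ℕ) + ∑ j : Fin r, (fl j.succ : ℕ) = n := by
      rw [Fin.sum_univ_succ, h0] at hle ⊢
      simp at hle ⊢
      omega
    rw [hn, ← hchoose] at hspec
    simp only [Fin.cons_succ] at hspec
    generalize Nat.multinomial (univ : Finset (Fin (r + 1))) _ = M at hspec ⊢
    rw [Fin.prod_univ_succ (fun j : Fin (r + 1) => b j ^ (fl j : ℕ) / _),
      Fin.prod_univ_succ (fun j : Fin (r + 1) => b j ^ _), h0]
    simp only [Fin.val_zero, hb0, one_pow, Fin.cons_succ, Finset.prod_div_distrib]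
    generalize ∑ j, (fl j : ℕ) = L at hspec hle ⊢
    have hspec' : (∏ j : Fin r, ((fl j.succ : ℕ).factorial : ℚ)) * M =
        n.choose L * L.factorial := by
      have : ((n - L).factorial : ℚ) ≠ 0 := by positivity
      apply mul_left_cancel₀ this
      rw [mul_comm _ ((n.choose L : ℚ) * _), ← mul_assoc]
      exact_mod_cast hspec
    have : (∏ j : Fin r, ((fl j.succ : ℕ).factorial : ℚ)) ≠ 0 :=
      Finset.prod_ne_zero_iff.mpr fun g _ => by positivity
    rw [← hspec']
    field_simp
    simp

/-- Tuples with values in the nonzero elements of a finite abelian group that sum to zero. -/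
theorem card_sum_eq_zero_fin {A M : Type*} [Fintype A] [AddCommGroup M] (f : A → M)
    (hf : Function.Injective f) (hf0 : ∀ a, f a ≠ 0)
    (hneg : ∀ (n : ℕ) (y : Fin n → A), ∑ i, f (y i) ≠ 0 → ∃ b, f b = -∑ i, f (y i)) (n : ℕ) :
    (Nat.card {y : Fin n → A // ∑ i, f (y i) = 0} : ℚ) =
      (Fintype.card A : ℚ) ^ n / (Fintype.card A + 1) +
        (-1) ^ n * (1 - 1 / (Fintype.card A + 1)) := by
  have hpos : (Fintype.card A : ℚ) + 1 ≠ 0 := by positivity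
  induction n with
  | zero => simp
  | succ n ih =>
    have e : {y : Fin (n + 1) → A // ∑ i, f (y i) = 0} ≃
        {y : Fin n → A // ¬ ∑ i, f (y i) = 0} := by
      refine Equiv.ofBijective (fun y => ⟨fun i => y.1 i.succ, fun h => ?_⟩) ⟨?_, ?_⟩
      · have := y.2
        rw [Fin.sum_univ_succ, h, add_zero] at this
        exact hf0 _ this
      · rintro ⟨y, hy⟩ ⟨y', hy'⟩ heq
        have heq : ∀ i : Fin n, y i.succ = y' i.succ := congrFun (Subtype.ext_iff.mp heq)
        ext i
        refine Fin.cases (hf ?_) heq i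
        rw [Fin.sum_univ_succ] at hy hy'
        simp only [heq] at hy
        exact add_right_cancel (hy.trans hy'.symm)
      · rintro ⟨y, hy⟩
        obtain ⟨b, hb⟩ := hneg n y hy
        exact ⟨⟨Fin.cons b y, by simp [Fin.sum_univ_succ, hb]⟩, rfl⟩
    classical
    have hcompl := Fintype.card_subtype_compl (fun y : Fin n → A => ∑ i, f (y i) = 0)
    have hle := Fintype.card_subtype_le (fun y : Fin n → A => ∑ i, f (y i) = 0)
    rw [Nat.card_congr e, Nat.card_eq_fintype_card, hcompl, Nat.cast_sub hle,
      ← Nat.card_eq_fintype_card (α := {y : Fin n → A // ∑ i, f (y i) = 0}), ih]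
    simp only [Fintype.card_fun, Fintype.card_fin, Nat.cast_pow]
    field_simp
    ring

theorem card_sum_eq_zero {ι A M : Type*} [Fintype ι] [Fintype A] [AddCommGroup M] (f : A → M)
    (hf : Function.Injective f) (hf0 : ∀ a, f a ≠ 0)
    (hneg : ∀ (n : ℕ) (y : Fin n → A), ∑ i, f (y i) ≠ 0 → ∃ b, f b = -∑ i, f (y i)) :
    (Nat.card {y : ι → A // ∑ i, f (y i) = 0} : ℚ) =
      (Fintype.card A : ℚ) ^ Fintype.card ι / (Fintype.card A + 1) +
        (-1) ^ Fintype.card ι * (1 - 1 / (Fintype.card A + 1)) := by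
  rw [← card_sum_eq_zero_fin f hf hf0 hneg]
  congr 1
  refine Nat.card_congr ((Equiv.arrowCongr (Fintype.equivFin ι) (Equiv.refl A)).subtypeEquiv ?_)
  intro y
  rw [← Equiv.sum_comp (Fintype.equivFin ι)]
  simp

theorem card_fiberwise_sum_eq_zero {ι A C M : Type*} [Fintype ι] [DecidableEq ι] [Fintype A] 
    [Fintype C] [DecidableEq C] [AddCommGroup M] (f : A → M)
    (hf : Function.Injective f) (hf0 : ∀ a, f a ≠ 0)
    (hneg : ∀ (n : ℕ) (y : Fin n → A), ∑ i, f (y i) ≠ 0 → ∃ b, f b = -∑ i, f (y i)) :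
    (Nat.card {x : ι → A × C // ∀ g, ∑ i with (x i).2 = g, f (x i).1 = 0} : ℚ) =
      ∑ c : ι → C, ∏ g, ((Fintype.card A : ℚ) ^ #{i | c i = g} / (Fintype.card A + 1) +
        (-1) ^ #{i | c i = g} * (1 - 1 / (Fintype.card A + 1))) := by
  have e : {x : ι → A × C // ∀ g, ∑ i with (x i).2 = g, f (x i).1 = 0} ≃
      Σ c : ι → C, ∀ g : C, {y : {i // c i = g} → A // ∑ i, f (y i) = 0} :=
    { toFun := fun x => ⟨fun i => (x.1 i).2, fun g => ⟨fun i => (x.1 i).1, 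
        (Finset.sum_subtype _ (by simp) fun i => f (x.1 i).1).symm.trans (x.2 g)⟩⟩
      invFun := fun z => ⟨fun i => ((z.2 (z.1 i)).1 ⟨i, rfl⟩, z.1 i), fun g => by
        refine Eq.trans ?_ (z.2 g).2
        rw [Finset.sum_subtype (p := fun i => z.1 i = g) _ (by simp)]
        refine Finset.sum_congr rfl ?_
        rintro ⟨i, rfl⟩ _
        rfl⟩
      left_inv := fun x => rfl
      right_inv := by
        rintro ⟨c, z⟩
        refine Sigma.ext rfl (heq_of_eq ?_)
        funext g
        ext ⟨i, rfl⟩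
        rfl }
  classical
  rw [Nat.card_congr e, Nat.card_sigma, Nat.cast_sum]
  refine Finset.sum_congr rfl fun c _ => ?_
  rw [Nat.card_pi, Nat.cast_prod]
  refine Finset.prod_congr rfl fun g _ => ?_
  rw [card_sum_eq_zero f hf hf0 hneg, Fintype.card_subtype]

/-- Vanishing power moments up to the number of points force vanishing fiber sums. -/
theorem fiber_sum_eq_zero_of_moments {ι C F : Type*} [Fintype ι] [DecidableEq C] [Field F]
    (κ : C → F) (hκ : Function.Injective κ) (c : ι → C) (b : ι → F) (n : ℕ)
    (hn : Fintype.card ι ≤ n) (hb : ∀ k < n, ∑ i, b i * κ (c i) ^ k = 0) (g : C) :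
    ∑ i with c i = g, b i = 0 := by
  by_cases hg : g ∈ univ.image c
  swap
  · refine Finset.sum_eq_zero fun i hi => absurd ?_ hg
    exact mem_image.mpr ⟨i, mem_univ i, (mem_filter.mp hi).2⟩
  set p : F[X] := ∏ g' ∈ (univ.image c).erase g, (X - Polynomial.C (κ g')) with hp
  have hdeg : p.natDegree < n := by
    rw [hp, natDegree_finsetProd_X_sub_C_eq_card, card_erase_of_mem hg]
    have := Finset.card_pos.mpr ⟨g, hg⟩
    have := Finset.card_image_le (s := univ) (f := c)
    rw [card_univ] at this
    omega
  have hzero : ∑ i, b i * p.eval (κ (c i)) = 0 := by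
    simp only [eval_eq_sum_range' hdeg, Finset.mul_sum]
    rw [Finset.sum_comm]
    refine Finset.sum_eq_zero fun k hk => ?_
    rw [← mul_zero (p.coeff k), ← hb k (mem_range.mp hk), Finset.mul_sum]
    exact Finset.sum_congr rfl fun i _ => by ring
  have hroot : ∀ i, c i ≠ g → p.eval (κ (c i)) = 0 := by
    intro i hi
    rw [hp, eval_prod]
    exact Finset.prod_eq_zero (mem_erase.mpr ⟨hi, mem_image_of_mem c (mem_univ i)⟩) (by simp)
  have hne : p.eval (κ g) ≠ 0 := by
    rw [hp, eval_prod]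
    refine Finset.prod_ne_zero_iff.mpr fun g' hg' => ?_
    rw [eval_sub, eval_X, eval_C, sub_ne_zero]
    exact hκ.ne (ne_of_mem_erase hg').symm
  refine (mul_eq_zero.mp ?_).resolve_right hne
  rw [← hzero, Finset.sum_mul, Finset.sum_filter]
  refine Finset.sum_congr rfl fun i _ => ?_
  split_ifs with hi
  · rw [hi]
  · rw [hroot i hi, mul_zero]

theorem odd_moments_eq_zero_iff {ι C F : Type*} [Fintype ι] [DecidableEq C] [Field F]
    [CharP F 2] (m q t : ℕ) (hq : q = 2 ^ m) (κ : C → F) (hκ : Function.Injective κ)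
    (hκq : ∀ g, κ g ^ (q + 1) = 1) (c : ι → C) (a : ι → F) (ha : ∀ i, a i ^ q = a i)
    (hι : Fintype.card ι ≤ 2 * t) :
    (∀ j, 1 ≤ j → j ≤ t → ∑ i, a i * κ (c i) ^ (2 * j - 1) = 0) ↔
      ∀ g, ∑ i with c i = g, a i = 0 := by
  have hne : ∀ g, κ g ≠ 0 := fun g h0 => by
    have := hκq g
    rw [h0, zero_pow (by omega)] at this
    exact zero_ne_one this
  constructor
  · intro hj
    have hconj : ∀ j, 1 ≤ j → j ≤ t → ∑ i, a i * (κ (c i))⁻¹ ^ (2 * j - 1) = 0 := by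
      intro j h1 h2
      have := congrArg (· ^ q) (hj j h1 h2)
      simp only [hq] at this
      rw [sum_pow_char_pow, zero_pow (by positivity), ← hq] at this
      rw [← this]
      refine Finset.sum_congr rfl fun i _ => ?_
      rw [mul_pow, ha, ← pow_mul, mul_comm _ q, pow_mul]
      rw [eq_inv_of_mul_eq_one_left ((pow_succ _ _).symm.trans (hκq (c i)))]
    have hsq : Function.Injective fun g => κ g ^ 2 := fun g g' h =>
      hκ (frobenius_inj F 2 h)
    intro g
    have key := fiber_sum_eq_zero_of_moments _ hsq c
      (fun i => a i * (κ (c i))⁻¹ ^ (2 * t - 1)) (2 * t) hι ?_ g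
    · refine (mul_eq_zero.mp ?_).resolve_right
        (pow_ne_zero (2 * t - 1) (inv_ne_zero (hne g)))
      rw [← key, Finset.sum_mul]
      refine Finset.sum_congr rfl fun i hi => ?_
      rw [(mem_filter.mp hi).2]
    · intro k hk
      rcases le_or_gt t k with htk | htk
      · rw [← hj (k - t + 1) (by omega) (by omega)]
        refine Finset.sum_congr rfl fun i _ => ?_
        rw [mul_assoc, ← pow_mul, show 2 * k = (2 * t - 1) + (2 * (k - t + 1) - 1) by omega,
          pow_add, ← mul_assoc _ (κ (c i) ^ (2 * t - 1)), ← mul_pow, inv_mul_cancel₀ (hne _),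
          one_pow, one_mul]
      · rw [← hconj (t - k) (by omega) (by omega)]
        refine Finset.sum_congr rfl fun i _ => ?_
        rw [mul_assoc, ← pow_mul, show 2 * t - 1 = (2 * (t - k) - 1) + 2 * k by omega,
          pow_add, mul_assoc, ← mul_pow, inv_mul_cancel₀ (hne _), one_pow, mul_one]
  · intro hg j _ _
    have hsplit := Finset.sum_fiberwise_of_maps_to (s := univ) (t := univ.image c) (g := c)
      (fun i _ => mem_image_of_mem c (mem_univ i)) fun i => a i * κ (c i) ^ (2 * j - 1)
    rw [← hsplit]
    refine Finset.sum_eq_zero fun g _ => ?_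
    rw [← zero_mul (κ g ^ (2 * j - 1)), ← hg g, Finset.sum_mul]
    refine Finset.sum_congr rfl fun i hi => ?_
    rw [(mem_filter.mp hi).2]

theorem card_pi_preimage {G H : Type*} [Group G] [Group H] [Finite G] [Finite H] (φ : G →* H)
    (hφ : Function.Surjective φ) (r : ℕ) (P : (Fin r → H) → Prop) :
    Nat.card {x : Fin r → G // P fun i => φ (x i)} =
      Nat.card φ.ker ^ r * Nat.card {y : Fin r → H // P y} := by
  have hfib : ∀ y : H, Nat.card {x // φ x = y} = Nat.card φ.ker := by
    intro y
    obtain ⟨x₀, rfl⟩ := hφ y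
    refine Nat.card_congr ((Equiv.mulLeft x₀⁻¹).subtypeEquiv fun x => ?_)
    simp [MonoidHom.mem_ker, inv_mul_eq_one, eq_comm (a := φ x)]
  have e : {x : Fin r → G // P fun i => φ (x i)} ≃
      Σ y : {y : Fin r → H // P y}, ∀ i, {x // φ x = y.1 i} :=
    { toFun := fun x => ⟨⟨fun i => φ (x.1 i), x.2⟩, fun i => ⟨x.1 i, rfl⟩⟩
      invFun := fun z => ⟨fun i => (z.2 i).1, by
        have : (fun i => φ (z.2 i).1) = z.1.1 := funext fun i => (z.2 i).2
        rw [this]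
        exact z.1.2⟩
      left_inv := fun x => rfl
      right_inv := by
        rintro ⟨⟨y, hy⟩, z⟩
        obtain ⟨x, hx, rfl⟩ : ∃ (x : Fin r → G) (hx : ∀ i, φ (x i) = y i),
            z = fun i => ⟨x i, hx i⟩ := ⟨fun i => (z i).1, fun i => (z i).2, rfl⟩
        obtain rfl : (fun i => φ (x i)) = y := funext hx
        rfl }
  cases nonempty_fintype {y : Fin r → H // P y}
  rw [Nat.card_congr e, Nat.card_sigma]
  simp only [Nat.card_pi, hfib]
  simp [mul_comm]

/-- Elements killed by both exponents of the decomposition of a Niho exponent. -/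
theorem niho_pow_eq_one_iff {G : Type*} [Group G] [Finite G] (w h Δ : ℕ) (hw : 0 < w)
    (hG : Nat.card G = (2 * w - 1) * (2 * w + 1)) (hΔ : Nat.gcd Δ (2 * w - 1) = 1) (x : G) :
    (x ^ (Δ * w * (2 * w + 1)) = 1 ∧ x ^ (h * ((2 * w - 1) * (w + 1))) = 1) ↔
      x ^ Nat.gcd h (2 * w + 1) = 1 := by
  simp only [← orderOf_dvd_iff_pow_eq_one]
  constructor
  · rintro ⟨hu, hv⟩
    have hx : orderOf x ∣ (2 * w - 1) * (2 * w + 1) := hG ▸ orderOf_dvd_natCard x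
    have hcop : Nat.Coprime (Δ * w) (2 * w - 1) := by
      refine Nat.Coprime.mul_left hΔ (Nat.Coprime.symm ?_)
      refine (Nat.coprime_of_mul_modEq_one 2 ?_).symm
      rw [mul_comm]
      exact (Nat.modEq_of_dvd (by rw [Nat.cast_sub (by omega)]; exact ⟨-1, by push_cast; ring⟩))
    have hq : orderOf x ∣ 2 * w + 1 := by
      have := Nat.dvd_gcd hu hx
      rwa [Nat.gcd_mul_right, hcop, one_mul] at this
    refine Nat.dvd_gcd (Nat.Coprime.dvd_of_dvd_mul_right ?_ hv) hq
    refine Nat.Coprime.coprime_dvd_left hq ?_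
    rw [← Nat.isCoprime_iff_coprime]
    push_cast [Nat.cast_sub (show 1 ≤ 2 * w by omega)]
    exact ⟨w, -1, by ring⟩
  · intro he
    exact ⟨(he.trans (Nat.gcd_dvd_right _ _)).mul_left _,
      (he.trans (Nat.gcd_dvd_left _ _)).mul_right _⟩

theorem niho_exponent_modEq_s12 (w h Δ d j : ℕ) (s : ℤ) (hw : 0 < w) (hj : 1 ≤ j)
    (hs : 2 * s ≡ 2 * (j : ℤ) * h + ((Δ : ℤ) - h) [ZMOD ((2 * w : ℤ) + 1)])
    (hd : (d : ℤ) ≡ s * ((2 * w : ℤ) - 1) + Δ [ZMOD ((2 * w : ℤ) ^ 2 - 1)]) :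
    d ≡ Δ * w * (2 * w + 1) + h * ((2 * w - 1) * (w + 1)) * (2 * j - 1)
      [MOD (2 * w - 1) * (2 * w + 1)] := by
  rw [← Int.natCast_modEq_iff]
  push_cast [Nat.cast_sub (show 1 ≤ 2 * w by omega), Nat.cast_sub (show 1 ≤ 2 * j by omega)]
  obtain ⟨l, hl⟩ := hs.symm.dvd
  obtain ⟨k, hk⟩ := hd.symm.dvd
  refine (Int.modEq_of_dvd (IsCoprime.mul_dvd ⟨w, 1 - w, by ring⟩ ?_ ?_)).symm
  · exact ⟨s + (2 * w + 1) * k - Δ * (w + 1) - h * (w + 1) * (2 * j - 1),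
      by linear_combination hk⟩
  · exact ⟨(2 * w - 1) * k + s - l - h * (2 * j - 1) * w - Δ * w,
      by linear_combination hk - hl⟩

/-- The homomorphism splitting a Niho power into its two components. -/
def nihoHom {G : Type*} [CommGroup G] (u v a c : ℕ) (hu : ∀ x : G, (x ^ u) ^ a = 1)
    (hv : ∀ x : G, (x ^ v) ^ c = 1) :
    G →* (powMonoidHom a : G →* G).ker × (powMonoidHom c : G →* G).ker :=
  ((powMonoidHom u).codRestrict _ hu).prod ((powMonoidHom v).codRestrict _ hv)

theorem card_ker_nihoHom_and_surjective {G : Type*} [CommGroup G] [Finite G] [IsCyclic G]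
    (w h Δ n : ℕ) (hw : 0 < w) (hG : Nat.card G = (2 * w - 1) * (2 * w + 1))
    (hΔ : Nat.gcd Δ (2 * w - 1) = 1) (hn : Nat.gcd h (2 * w + 1) * n = 2 * w + 1)
    (hu : ∀ x : G, (x ^ (Δ * w * (2 * w + 1))) ^ (2 * w - 1) = 1)
    (hv : ∀ x : G, (x ^ (h * ((2 * w - 1) * (w + 1)))) ^ n = 1) :
    Nat.card (nihoHom _ _ _ _ hu hv).ker = Nat.gcd h (2 * w + 1) ∧
      Function.Surjective (nihoHom _ _ _ _ hu hv) := by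
  have hker : (nihoHom _ _ _ _ hu hv).ker =
      (powMonoidHom (Nat.gcd h (2 * w + 1)) : G →* G).ker := by
    ext x
    rw [MonoidHom.mem_ker, MonoidHom.mem_ker, powMonoidHom_apply,
      ← niho_pow_eq_one_iff w h Δ hw hG hΔ]
    simp only [nihoHom, MonoidHom.prod_apply, Prod.mk_eq_one, Subtype.ext_iff]
    rfl
  have hcard : Nat.card (nihoHom _ _ _ _ hu hv).ker = Nat.gcd h (2 * w + 1) := by
    rw [hker, IsCyclic.card_powMonoidHom_ker, hG]
    exact Nat.gcd_eq_right ((Nat.gcd_dvd_right _ _).mul_left _)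
  refine ⟨hcard, MonoidHom.surjective_of_card_ker_le_div _ ?_⟩
  have hn0 : 0 < n := Nat.pos_of_ne_zero (by rintro rfl; omega)
  have h1 : Nat.card (powMonoidHom (2 * w - 1) : G →* G).ker = 2 * w - 1 := by
    rw [IsCyclic.card_powMonoidHom_ker, hG]
    exact Nat.gcd_eq_right (dvd_mul_right _ _)
  have h2 : Nat.card (powMonoidHom n : G →* G).ker = n := by
    rw [IsCyclic.card_powMonoidHom_ker, hG]
    exact Nat.gcd_eq_right ((Dvd.intro_left _ hn).mul_left _)
  rw [hcard, Nat.card_prod, h1, h2, hG,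
    Nat.le_div_iff_mul_le (Nat.mul_pos (by omega) hn0)]
  nlinarith

theorem card_niho_solutions (m w n : ℕ) (hw : 0 < w) (hq : 2 * w = 2 ^ m)
    (F : Type*) [Field F] [Fintype F] (hF : Fintype.card F = (2 * w) ^ 2)
    (h Δ : ℕ) (hΔ : Nat.gcd Δ (2 * w - 1) = 1) (hn : Nat.gcd h (2 * w + 1) * n = 2 * w + 1)
    (t : ℕ) (d : ℕ → ℕ) (s : ℕ → ℤ)
    (hs : ∀ j, 1 ≤ j → j ≤ t →
      2 * s j ≡ 2 * (j : ℤ) * h + ((Δ : ℤ) - h) [ZMOD ((2 * w : ℤ) + 1)])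
    (hd : ∀ j, 1 ≤ j → j ≤ t →
      (d j : ℤ) ≡ s j * ((2 * w : ℤ) - 1) + Δ [ZMOD ((2 * w : ℤ) ^ 2 - 1)])
    (r : ℕ) (hr : r ≤ 2 * t) :
    (Nat.card {x : Fin r → Fˣ // ∀ j, 1 ≤ j → j ≤ t → ∑ i, ((x i : F)) ^ d j = 0} : ℚ) =
      (r.factorial : ℚ) * (Nat.gcd h (2 * w + 1) : ℚ) ^ r *
        coeff ((∑ j : Fin (r + 1), monomial (j : ℕ)
          ((((2 * w : ℚ) - 1) ^ (j : ℕ) / (2 * w) + (-1) ^ (j : ℕ) * (1 - 1 / (2 * w))) /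
            (j : ℕ).factorial)) ^ n) r := by
  classical
  have hp : Fact (Nat.Prime 2) := ⟨Nat.prime_two⟩
  have hchar : CharP F 2 := charP_of_card_eq_prime_pow (f := m * 2) (by rw [hF, hq, pow_mul])
  have hG : Nat.card Fˣ = (2 * w - 1) * (2 * w + 1) := by
    rw [Nat.card_eq_fintype_card, Fintype.card_units, hF,
      mul_comm (2 * w - 1), ← Nat.sq_sub_sq, one_pow]
  have hone : ∀ (x : Fˣ) (k : ℕ), (2 * w - 1) * (2 * w + 1) ∣ k → x ^ k = 1 := fun x k hk =>
    orderOf_dvd_iff_pow_eq_one.mp ((hG ▸ orderOf_dvd_natCard x).trans hk)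
  have hu : ∀ x : Fˣ, (x ^ (Δ * w * (2 * w + 1))) ^ (2 * w - 1) = 1 := by
    intro x
    rw [← pow_mul]
    exact hone x _ ⟨Δ * w, by ring⟩
  have hv : ∀ x : Fˣ, (x ^ (h * ((2 * w - 1) * (w + 1)))) ^ n = 1 := by
    intro x
    rw [← pow_mul]
    obtain ⟨h', hh'⟩ := Nat.gcd_dvd_left h (2 * w + 1)
    refine hone x _ ⟨h' * (w + 1), ?_⟩
    generalize Nat.gcd h (2 * w + 1) = e at hn hh'
    rw [hh', ← hn]
    ring
  obtain ⟨hcard, hsurj⟩ := card_ker_nihoHom_and_surjective w h Δ n hw hG hΔ hn hu hv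
  set A := (powMonoidHom (2 * w - 1) : Fˣ →* Fˣ).ker with hA
  set C := (powMonoidHom n : Fˣ →* Fˣ).ker with hC
  set φ := nihoHom _ _ _ _ hu hv with hφ
  have hAcard : (Fintype.card A : ℚ) = 2 * w - 1 := by
    rw [← Nat.card_eq_fintype_card, hA, IsCyclic.card_powMonoidHom_ker, hG,
      Nat.gcd_eq_right (dvd_mul_right _ _), Nat.cast_sub (by omega)]
    push_cast
    rfl
  have hCcard : Fintype.card C = n := by
    rw [← Nat.card_eq_fintype_card, hC, IsCyclic.card_powMonoidHom_ker, hG]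
    exact Nat.gcd_eq_right ((Dvd.intro_left _ hn).mul_left _)
  have hApow : ∀ a : A, ((a : Fˣ) : F) ^ (2 * w) = ((a : Fˣ) : F) := by
    rintro ⟨a, ha⟩
    have ha : a ^ (2 * w - 1) = 1 := ha
    have := congrArg (fun x : Fˣ => ((x * a : Fˣ) : F)) ha
    simpa [← pow_succ, show 2 * w - 1 + 1 = 2 * w by omega] using this
  have hCpow : ∀ c : C, ((c : Fˣ) : F) ^ (2 * w + 1) = 1 := by
    rintro ⟨c, hc⟩
    have hc : c ^ n = 1 := hc
    rw [← hn, mul_comm, pow_mul]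
    simpa using congrArg (fun x : Fˣ => (x : F) ^ Nat.gcd h (2 * w + 1)) hc
  have hinj : ∀ B : Subgroup Fˣ, Function.Injective fun b : B => ((b : Fˣ) : F) := fun B =>
    Units.val_injective.comp Subtype.val_injective
  have hneg : ∀ (k : ℕ) (y : Fin k → A), ∑ i, ((y i : Fˣ) : F) ≠ 0 →
      ∃ b : A, ((b : Fˣ) : F) = -∑ i, ((y i : Fˣ) : F) := by
    intro k y hy
    refine ⟨⟨Units.mk0 _ hy, ?_⟩, (CharTwo.neg_eq _).symm⟩
    refine MonoidHom.mem_ker.mpr (Units.ext ?_)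
    rw [powMonoidHom_apply]
    rw [Units.val_pow_eq_pow_val, Units.val_mk0, Units.val_one]
    apply mul_right_cancel₀ hy
    rw [← pow_succ, show 2 * w - 1 + 1 = 2 * w by omega, hq, sum_pow_char_pow, one_mul, ← hq]
    exact Finset.sum_congr rfl fun i _ => hApow (y i)
  have hpow : ∀ j, 1 ≤ j → j ≤ t → ∀ x : Fˣ,
      (x : F) ^ d j = (((φ x).1 : Fˣ) : F) * (((φ x).2 : Fˣ) : F) ^ (2 * j - 1) := by
    intro j h1 h2 x
    have hmod := niho_exponent_modEq_s12 w h Δ (d j) j (s j) hw h1 (hs j h1 h2) (hd j h1 h2)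
    have hx := pow_eq_pow_iff_modEq.mpr (hmod.of_dvd (hG ▸ orderOf_dvd_natCard x))
    rw [← Units.val_pow_eq_pow_val, hx, pow_add, pow_mul x (h * _)]
    push_cast
    rfl
  have hiff : ∀ x : Fin r → Fˣ,
      (∀ j, 1 ≤ j → j ≤ t → ∑ i, ((x i : F)) ^ d j = 0) ↔
        ∀ g, ∑ i with (φ (x i)).2 = g, (((φ (x i)).1 : Fˣ) : F) = 0 := by
    intro x
    rw [← odd_moments_eq_zero_iff m (2 * w) t hq (fun c : C => ((c : Fˣ) : F)) (hinj C) hCpow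
      (fun i => (φ (x i)).2) (fun i => (((φ (x i)).1 : Fˣ) : F)) (fun i => hApow _)
      (by simpa using hr)]
    refine forall_congr' fun j => forall_congr' fun h1 => forall_congr' fun h2 => ?_
    simp only [hpow j h1 h2]
  rw [Nat.card_congr (Equiv.subtypeEquivRight hiff),
    card_pi_preimage φ hsurj r fun y => ∀ g, ∑ i with (y i).2 = g, (((y i).1 : Fˣ) : F) = 0,
    hcard, Nat.cast_mul, Nat.cast_pow,
    card_fiberwise_sum_eq_zero (fun a : A => ((a : Fˣ) : F)) (hinj A) (fun a => Units.ne_zero _)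
      hneg,
    sum_prod_fiber_card_eq_coeff (C := C) (fun k => (Fintype.card A : ℚ) ^ k /
      (Fintype.card A + 1) + (-1) ^ k * (1 - 1 / (Fintype.card A + 1))), hCcard, hAcard,
    sub_add_cancel]
  ring

end

/-- Appendix I, case `C⁽²⁾` with `p = 2`: with `q = 2^m`, `F` the field with `q²` elements
and Niho-type exponents `d̃_1, …, d̃_t` as in the paper, for `0 ≤ r ≤ 2t` the number `N_r`
of `r`-tuples `(x₁, …, x_r) ∈ (F_{q²}^*)^r` with `x₁^{d̃_j} + ⋯ + x_r^{d̃_j} = 0` for all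
`1 ≤ j ≤ t` satisfies `N_0 = 1`, `N_1 = 0`, and for `r ≥ 2`,
`N_r = r! e^r ∑_{λ : ∑_{j≥2} jλ_j = r} C((q+1)/e, L) L! ∏_j (B_j/j!)^{λ_j}/λ_j!` where
`L = ∑_j λ_j` and `B_j = q⁻¹(q-1)^j + (-1)^j(1-q⁻¹)`. -/
theorem stmt_12 (m : ℕ) (hm : 0 < m) (q : ℕ) (hq : q = 2 ^ m)
    (F : Type*) [Field F] [Fintype F] (hF : Fintype.card F = q ^ 2)
    (γ : Fˣ) (hγ : ∀ x : Fˣ, x ∈ Subgroup.zpowers γ)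
    (h Δ : ℕ) (hh : 0 < h) (hΔpos : 0 < Δ)
    (hhq : ¬ (q + 1) ∣ h) (hΔ : Nat.gcd Δ (q - 1) = 1)
    (e : ℕ) (he : e = Nat.gcd h (q + 1))
    (t : ℕ) (ht1 : 1 ≤ t) (ht : 2 * e * t ≤ q + 1)
    (d : ℕ → ℕ) (s : ℕ → ℤ)
    (hdpos : ∀ j, 1 ≤ j → j ≤ t → 0 < d j)
    (hs : ∀ j, 1 ≤ j → j ≤ t →
      2 * s j ≡ 2 * (j : ℤ) * h + ((Δ : ℤ) - h) [ZMOD ((q : ℤ) + 1)])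
    (hd : ∀ j, 1 ≤ j → j ≤ t →
      (d j : ℤ) ≡ s j * ((q : ℤ) - 1) + Δ [ZMOD ((q : ℤ) ^ 2 - 1)])
    (r : ℕ) (hr : r ≤ 2 * t)
    (N : ℕ)
    (hN : N = Nat.card
      {x : Fin r → Fˣ // ∀ j, 1 ≤ j → j ≤ t → ∑ i, ((x i : F)) ^ d j = 0}) :
    (r = 0 → N = 1) ∧ (r = 1 → N = 0) ∧
    (2 ≤ r → (N : ℚ) =
      (r.factorial : ℚ) * (e : ℚ) ^ r *
        ∑ fl ∈ Finset.univ.filter (fun fl : Fin (r + 1) → Fin (r + 1) =>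
            (∀ j : Fin (r + 1), (j : ℕ) < 2 → fl j = 0) ∧
            ∑ j : Fin (r + 1), (j : ℕ) * (fl j : ℕ) = r),
          (((q + 1) / e).choose (∑ j, (fl j : ℕ)) : ℚ) *
            ((∑ j, (fl j : ℕ)).factorial : ℚ) *
            ∏ j : Fin (r + 1),
              ((((q : ℚ) - 1) ^ (j : ℕ) / q + (-1) ^ (j : ℕ) * (1 - 1 / q)) /
                  ((j : ℕ).factorial : ℚ)) ^ (fl j : ℕ) /
                ((fl j : ℕ).factorial : ℚ)) := by
  obtain ⟨w, rfl⟩ : ∃ w, q = 2 * w := hq ▸ dvd_pow_self 2 hm.ne'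
  subst he hN
  have hw : 0 < w := by
    have := Nat.two_pow_pos m
    omega
  refine ⟨?_, ?_, fun _ => ?_⟩
  · rintro rfl
    simp
  · rintro rfl
    rw [Nat.card_eq_zero]
    refine Or.inl ⟨fun x => ?_⟩
    have := x.2 1 le_rfl ht1
    simp at this
  · have hdvd := Nat.gcd_dvd_right h (2 * w + 1)
    rw [card_niho_solutions m w ((2 * w + 1) / Nat.gcd h (2 * w + 1)) hw hq F hF h Δ hΔ
      (Nat.mul_div_cancel' hdvd) t d s (by exact_mod_cast hs) (by exact_mod_cast hd) r hr]
    have hcoeff := coeff_sum_monomial_pow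
      (fun j => (((2 * w : ℚ) - 1) ^ j / (2 * w) + (-1) ^ j * (1 - 1 / (2 * w))) / j.factorial)
      (by simp) (by field_simp; ring) ((2 * w + 1) / Nat.gcd h (2 * w + 1)) r
    rw [hcoeff]
    push_cast
    rfl
end

section
/- For any t with 2 ≤ t ≤ (q+1)/(2e), the number of triples (x_1, x_2, x_3) ∈ (F_{q²}^*)³ satisfying x_1^{d_j} + x_2^{d_j} + x_3^{d_j} = 0 simultaneously for all 0 ≤ j ≤ t equals e²(q−2)(q² − 1). -/
/-- In a finite cyclic group, a nonempty simultaneous fibre of the maps `v ↦ v ^ n` (over `1`) and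
`v ↦ v ^ k` has as many elements as the intersection of the two kernels. -/
lemma card_pow_eq_one_and_pow_eq {G : Type*} [CommGroup G] [IsCyclic G] [Finite G] (n k : ℕ)
    (a v₀ : G) (hn : v₀ ^ n = 1) (hk : v₀ ^ k = a) :
    Nat.card {v : G // v ^ n = 1 ∧ v ^ k = a} = ((Nat.card G).gcd n).gcd k := by
  rw [Nat.gcd_assoc, ← IsCyclic.card_powMonoidHom_ker]
  refine Nat.card_congr ((Equiv.mulLeft v₀⁻¹).subtypeEquiv fun v ↦ ?_)
  rw [MonoidHom.mem_ker, powMonoidHom_apply, pow_gcd_eq_one]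
  simp [mul_pow, hn, hk, inv_mul_eq_one, eq_comm]

/-- The number of `u` in a finite cyclic group with `u ^ n = 1` and `u ^ k ≠ 1`. -/
lemma card_pow_eq_one_and_pow_ne_one {G : Type*} [CommGroup G] [IsCyclic G] [Finite G] (n k : ℕ) :
    Nat.card {u : G // u ^ n = 1 ∧ u ^ k ≠ 1} =
      (Nat.card G).gcd n - ((Nat.card G).gcd n).gcd k := by
  have h1 : Nat.card {u : G // u ^ n = 1 ∧ u ^ k = 1} = _ :=
    card_pow_eq_one_and_pow_eq n k 1 1 (one_pow n) (one_pow k)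
  have h2 : Nat.card {u : G // u ^ n = 1} = (Nat.card G).gcd n := by
    rw [← IsCyclic.card_powMonoidHom_ker]
    rfl
  rw [← h1, ← h2]
  change ({u : G | u ^ n = 1 ∧ u ^ k ≠ 1} : Set G).ncard =
    ({u : G | u ^ n = 1} : Set G).ncard - ({u : G | u ^ n = 1 ∧ u ^ k = 1} : Set G).ncard
  rw [← Set.ncard_sdiff (fun u hu ↦ hu.1)]
  congr 1
  ext u
  simp only [Set.mem_ofPred_eq, Set.mem_sdiff]
  tauto

/-- A three-term Vandermonde system with nonzero coefficients has a solution only if all the nodes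
coincide. -/
lemma eq_of_vandermonde_three {F : Type*} [Field F] {a b c x y z : F} (ha : a ≠ 0) (hb : b ≠ 0)
    (hc : c ≠ 0) (h0 : a + b + c = 0) (h1 : a * x + b * y + c * z = 0)
    (h2 : a * x ^ 2 + b * y ^ 2 + c * z ^ 2 = 0) : y = x ∧ z = x := by
  have key : b * ((y - x) * (y - z)) = 0 := by
    linear_combination h2 - (x + z) * h1 + x * z * h0
  rcases mul_eq_zero.1 ((mul_eq_zero.1 key).resolve_left hb) with h | h
  · have : c * (z - x) = 0 := by linear_combination h1 - x * h0 - b * h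
    exact ⟨sub_eq_zero.1 h, sub_eq_zero.1 ((mul_eq_zero.1 this).resolve_left hc)⟩
  · have : a * (z - x) = 0 := by linear_combination z * h0 - h1 + b * h
    have hz := sub_eq_zero.1 ((mul_eq_zero.1 this).resolve_left ha)
    exact ⟨(sub_eq_zero.1 h).trans hz, hz⟩

/-- The solutions of `v ^ k = 1 + u ^ k` with `u`, `v` in the kernel of the `r * h`-th power map,
over a field of characteristic two with `(r + 1) ^ 2` elements. -/
lemma card_one_add_pow_eq {F : Type*} [Field F] [Fintype F] [CharP F 2] {m r h k e : ℕ}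
    (hr : r + 1 = 2 ^ m) (hF : Fintype.card F = (r + 1) ^ 2) (he : e = Nat.gcd h (r + 2))
    (hk : r + 2 ∣ k) (hkr : Nat.Coprime k r) :
    Nat.card {p : Fˣ × Fˣ // p.1 ^ (r * h) = 1 ∧ p.2 ^ (r * h) = 1 ∧
      (1 : F) + p.1 ^ k + p.2 ^ k = 0} = e * (r * e - e) := by
  have hN : Nat.card Fˣ = r * (r + 2) := by
    rw [Nat.card_units, Nat.card_eq_fintype_card, hF, Nat.sub_eq_iff_eq_add (Nat.one_le_pow _ (r + 1) r.succ_pos)]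
    ring
  have hg1 : (Nat.card Fˣ).gcd (r * h) = r * e := by
    rw [hN, Nat.gcd_mul_left, he, Nat.gcd_comm h]
  have hg2 : ((Nat.card Fˣ).gcd (r * h)).gcd k = e := by
    rw [hg1, Nat.Coprime.gcd_mul_left_cancel _ hkr.symm]
    exact Nat.gcd_eq_left ((he ▸ Nat.gcd_dvd_right h (r + 2)).trans hk)
  have hfib (u : {u : Fˣ // u ^ (r * h) = 1 ∧ u ^ k ≠ 1}) :
      Nat.card {v : Fˣ // v ^ (r * h) = 1 ∧ (1 : F) + (u.1 : F) ^ k + (v : F) ^ k = 0} = e := by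
    obtain ⟨u, hu1, hu2⟩ := u
    have hne : (1 : F) + (u : F) ^ k ≠ 0 := by
      intro h0
      apply hu2
      ext
      push_cast
      exact (CharTwo.add_eq_zero.1 h0).symm
    obtain ⟨a, ha⟩ : ∃ a : Fˣ, (a : F) = 1 + (u : F) ^ k := ⟨Units.mk0 _ hne, rfl⟩
    have hukr : (u ^ k) ^ r = 1 := by
      obtain ⟨l, rfl⟩ := hk
      rw [← pow_mul, show (r + 2) * l * r = (r * (r + 2)) * l by ring, pow_mul, ← hN,
        pow_card_eq_one', one_pow]
    have har : a ^ r = 1 := by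
      have h1 : a ^ (r + 1) = a := by
        have h2 : ((u : F) ^ k) ^ (r + 1) = (u : F) ^ k := by
          rw [pow_succ, ← Units.val_pow_eq_pow_val, ← Units.val_pow_eq_pow_val, hukr, Units.val_one,
            one_mul]
        ext
        push_cast
        rw [ha]
        nth_rw 2 [← h2]
        rw [hr, add_pow_char_pow, one_pow]
      rw [pow_succ] at h1
      exact mul_eq_right.1 h1
    obtain ⟨v₀, hv1, hv2⟩ : ∃ v₀ : Fˣ, v₀ ^ (r * h) = 1 ∧ v₀ ^ k = a := by
      have hb := Nat.gcd_eq_gcd_ab k r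
      rw [hkr.gcd_eq_one] at hb
      refine ⟨a ^ (Nat.gcdA k r), ?_, ?_⟩
      · rw [← zpow_natCast, ← zpow_mul, mul_comm, zpow_mul, zpow_natCast, pow_mul, har]
        simp
      · have : a ^ (1 : ℤ) = a := zpow_one a
        push_cast at hb
        rw [hb, zpow_add, zpow_mul _ (r : ℤ), zpow_natCast, har, one_zpow, mul_one, mul_comm,
          zpow_mul, zpow_natCast] at this
        exact this
    rw [← hg2, ← card_pow_eq_one_and_pow_eq (r * h) k a v₀ hv1 hv2]
    refine Nat.card_congr (Equiv.subtypeEquivRight fun v ↦ and_congr_right fun _ ↦ ?_)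
    rw [CharTwo.add_eq_zero, ← ha, eq_comm, ← Units.val_pow_eq_pow_val, Units.val_inj]
  have hequiv : {p : Fˣ × Fˣ // p.1 ^ (r * h) = 1 ∧ p.2 ^ (r * h) = 1 ∧
      (1 : F) + p.1 ^ k + p.2 ^ k = 0} ≃
      Σ u : {u : Fˣ // u ^ (r * h) = 1 ∧ u ^ k ≠ 1},
        {v : Fˣ // v ^ (r * h) = 1 ∧ (1 : F) + (u.1 : F) ^ k + (v : F) ^ k = 0} :=
    { toFun := fun p ↦ ⟨⟨p.1.1, p.2.1, by
        intro h0
        have h3 := p.2.2.2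
        rw [← Units.val_pow_eq_pow_val, h0, Units.val_one, CharTwo.add_self_eq_zero, zero_add,
          ← Units.val_pow_eq_pow_val] at h3
        exact Units.ne_zero _ h3⟩, ⟨p.1.2, p.2.2⟩⟩
      invFun := fun x ↦ ⟨(x.1.1, x.2.1), x.1.2.1, x.2.2⟩
      left_inv := fun _ ↦ rfl
      right_inv := fun _ ↦ rfl }
  classical
  rw [Nat.card_congr hequiv, Nat.card_sigma, Finset.sum_congr rfl fun u _ ↦ hfib u,
    Finset.sum_const, Finset.card_univ, ← Nat.card_eq_fintype_card,
    card_pow_eq_one_and_pow_ne_one, hg2, hg1, smul_eq_mul, mul_comm]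

/-- Normalising the first coordinate: if `x ^ d j = x ^ d 0 * (x ^ n) ^ j`, then the solutions of
the power-sum system are determined by `x 0` and the ratios `x 1 / x 0`, `x 2 / x 0`. -/
lemma card_power_sum_solutions {F : Type*} [Field F] [Finite F] {n t : ℕ} (ht : 2 ≤ t)
    {d : ℕ → ℕ} (hd : ∀ j ≤ t, ∀ x : Fˣ, x ^ d j = x ^ d 0 * (x ^ n) ^ j) :
    Nat.card {x : Fin 3 → Fˣ // ∀ j ≤ t, ∑ i, (x i : F) ^ d j = 0} =
      Nat.card Fˣ * Nat.card {p : Fˣ × Fˣ // p.1 ^ n = 1 ∧ p.2 ^ n = 1 ∧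
        (1 : F) + p.1 ^ d 0 + p.2 ^ d 0 = 0} := by
  have hd' : ∀ j ≤ t, ∀ x : Fˣ, (x : F) ^ d j = (x : F) ^ d 0 * ((x : F) ^ n) ^ j :=
    fun j hj x ↦ by exact_mod_cast congrArg Units.val (hd j hj x)
  rw [← Nat.card_prod]
  refine Nat.card_congr
    { toFun := fun x ↦ (x.1 0, ⟨(x.1 1 / x.1 0, x.1 2 / x.1 0), ?_⟩)
      invFun := fun y ↦ ⟨![y.1, y.1 * y.2.1.1, y.1 * y.2.1.2], ?_⟩
      left_inv := ?_
      right_inv := ?_ }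
  · obtain ⟨x, hx⟩ := x
    have h0 := hx 0 (by omega)
    have h1 := hx 1 (by omega)
    have h2 := hx 2 ht
    simp only [Fin.sum_univ_three] at h0 h1 h2
    simp only [hd' 1 (by omega), pow_one] at h1
    simp only [hd' 2 ht] at h2
    have hne (i : Fin 3) : (x i : F) ^ d 0 ≠ 0 := pow_ne_zero _ (Units.ne_zero _)
    obtain ⟨e1, e2⟩ := eq_of_vandermonde_three (hne 0) (hne 1) (hne 2) h0 h1 h2
    refine ⟨?_, ?_, ?_⟩
    · rw [div_pow, div_eq_one]
      exact_mod_cast e1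
    · rw [div_pow, div_eq_one]
      exact_mod_cast e2
    · have := hne 0
      simp only [Units.val_div_eq_div_val, div_pow]
      field_simp
      simpa using h0
  · obtain ⟨a, ⟨u, v⟩, hu, hv, huv⟩ := y
    dsimp only at hu hv huv
    intro j hj
    have hu' : (u : F) ^ n = 1 := by rw [← Units.val_pow_eq_pow_val, hu, Units.val_one]
    have hv' : (v : F) ^ n = 1 := by rw [← Units.val_pow_eq_pow_val, hv, Units.val_one]
    simp only [Fin.sum_univ_three, Matrix.cons_val_zero, Matrix.cons_val_one, Matrix.cons_val,
      hd' j hj, Units.val_mul, mul_pow, hu', hv', mul_one]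
    linear_combination ((a : F) ^ d 0 * ((a : F) ^ n) ^ j) * huv
  · rintro ⟨x, hx⟩
    ext i
    fin_cases i <;> simp
  · rintro ⟨a, ⟨u, v⟩, h⟩
    simp

/-- The congruence properties of the Niho-type exponents modulo `q ^ 2 - 1`, with `q = r + 1`. -/
lemma niho_exponent_congruences {r h Δ t : ℕ} (hr : Odd r) (hΔ : Nat.gcd Δ r = 1)
    {d : ℕ → ℕ} {s : ℕ → ℤ}
    (hs : ∀ j ≤ t, 2 * s j ≡ 2 * (j : ℤ) * h + Δ [ZMOD (r : ℤ) + 2])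
    (hd : ∀ j ≤ t, (d j : ℤ) ≡ s j * r + Δ [ZMOD (r : ℤ) * (r + 2)]) :
    r + 2 ∣ d 0 ∧ Nat.Coprime (d 0) r ∧
      ∀ j ≤ t, d j ≡ d 0 + r * h * j [MOD r * (r + 2)] := by
  obtain ⟨A, hA⟩ := (hs 0 (Nat.zero_le t)).dvd
  obtain ⟨B, hB⟩ := (hd 0 (Nat.zero_le t)).dvd
  push_cast at hA
  refine ⟨?_, ?_, fun j hj ↦ ?_⟩
  · zify
    exact ⟨s 0 + A - r * B, by linear_combination -hB + hA⟩
  · have : (d 0 : ℤ) ≡ Δ [ZMOD r] :=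
      Int.modEq_iff_dvd.2 ⟨(r + 2) * B - s 0, by linear_combination hB⟩
    exact (Int.natCast_modEq_iff.1 this).gcd_eq.trans hΔ
  · obtain ⟨C, hC⟩ := (hs j hj).dvd
    obtain ⟨D, hD⟩ := (hd j hj).dvd
    have hev : (2 : ℤ) ∣ A - C := by
      have h2 : (2 : ℤ) ∣ ((r : ℤ) + 2) * (A - C) :=
        ⟨s j - s 0 - j * h, by linear_combination hC - hA⟩
      refine (Int.prime_two.dvd_mul.1 h2).resolve_left ?_
      obtain ⟨l, rfl⟩ := hr
      push_cast
      omega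
    obtain ⟨E, hE⟩ := hev
    have hsj : s j = s 0 + j * h + (r + 2) * E := by
      have : 2 * s j = 2 * (s 0 + j * h + (r + 2) * E) := by
        linear_combination hA - hC + ((r : ℤ) + 2) * hE
      linarith
    rw [← Int.natCast_modEq_iff]
    push_cast
    exact Int.modEq_iff_dvd.2 ⟨D - B - E, by linear_combination hD - hB - (r : ℤ) * hsj⟩

/-- `N_3 = e²(q-2)(q² - 1)`: with `p = 2`, `q = 2^m`, `F` the field with `q²` elements and
Niho-type exponents `d_0, …, d_t` as in the paper, for `2 ≤ t ≤ (q+1)/(2e)` the number of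
triples `(x₁, x₂, x₃) ∈ (F_{q²}^*)³` with `x₁^{d_j} + x₂^{d_j} + x₃^{d_j} = 0` for all
`0 ≤ j ≤ t` equals `e²(q-2)(q² - 1)`. -/
theorem stmt_15 (m : ℕ) (hm : 0 < m) (q : ℕ) (hq : q = 2 ^ m)
    (F : Type*) [Field F] [Fintype F] (hF : Fintype.card F = q ^ 2)
    (γ : Fˣ) (hγ : ∀ x : Fˣ, x ∈ Subgroup.zpowers γ)
    (h Δ : ℕ) (hh : 0 < h) (hΔpos : 0 < Δ)
    (hhq : ¬ (q + 1) ∣ h) (hΔ : Nat.gcd Δ (q - 1) = 1)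
    (e : ℕ) (he : e = Nat.gcd h (q + 1))
    (t : ℕ) (ht2 : 2 ≤ t) (ht : 2 * e * t ≤ q + 1)
    (d : ℕ → ℕ) (s : ℕ → ℤ)
    (hdpos : ∀ j ≤ t, 0 < d j)
    (hs : ∀ j ≤ t, 2 * s j ≡ 2 * (j : ℤ) * h + Δ [ZMOD ((q : ℤ) + 1)])
    (hd : ∀ j ≤ t, (d j : ℤ) ≡ s j * ((q : ℤ) - 1) + Δ [ZMOD ((q : ℤ) ^ 2 - 1)]) :
    Nat.card {x : Fin 3 → Fˣ // ∀ j ≤ t, ∑ i, ((x i : F)) ^ d j = 0} =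
      e ^ 2 * (q - 2) * (q ^ 2 - 1) := by
  obtain ⟨r, rfl⟩ : ∃ r, q = r + 1 := ⟨q - 1, by have := Nat.one_le_two_pow (n := m); omega⟩
  have hr : Odd r := by
    have : Even (r + 1) := hq ▸ (even_two.pow_of_ne_zero hm.ne')
    exact Nat.not_even_iff_odd.1 (Nat.even_add_one.1 this)
  have hchar : CharP F 2 := by
    rw [hq, ← pow_mul] at hF
    exact charP_of_card_eq_prime_pow hF
  rw [Nat.add_sub_cancel] at hΔ
  obtain ⟨h1, h2, h3⟩ := niho_exponent_congruences (s := s) hr hΔ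
    (fun j hj ↦ by
      have := hs j hj
      push_cast at this
      rwa [add_assoc, one_add_one_eq_two] at this)
    (fun j hj ↦ by
      have := hd j hj
      push_cast at this
      rwa [add_sub_cancel_right, show ((r : ℤ) + 1) ^ 2 - 1 = r * (r + 2) by ring] at this)
  have hN : (r + 1) ^ 2 - 1 = r * (r + 2) := by
    rw [Nat.sub_eq_iff_eq_add (Nat.one_le_pow _ (r + 1) r.succ_pos)]
    ring
  have hcard : Nat.card Fˣ = r * (r + 2) := by
    rw [Nat.card_units, Nat.card_eq_fintype_card, hF, hN]
  rw [card_power_sum_solutions (n := r * h) ht2, card_one_add_pow_eq hq hF he h1 h2, hcard, hN]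
  · have : r * e - e = (r - 1) * e := by rw [Nat.sub_mul, one_mul]
    rw [this, show r + 1 - 2 = r - 1 by omega]
    ring
  · intro j hj x
    rw [← pow_mul, ← pow_add]
    exact pow_eq_pow_of_modEq (h3 j hj) (hcard ▸ pow_card_eq_one')
end

section
/- For 0 ≤ t ≤ (q+1)/(2e) and 0 ≤ j ≤ 2t, let μ_j be the number of nonzero a = (a_0, a_1, …, a_t) ∈ F_q × (F_{q²})^t for which the codeword c(a) of C^(1) has Hamming weight w_j = (q² − (je−1)q)/2. Then for every integer i with 0 ≤ i ≤ 2t, Σ_{j=0}^{2t} (jeq − q − 1)^i · μ_j = q^{2t+1}·N_i − (q² − 1)^i, where N_0 = 1, N_1 = 0, and for i ≥ 2, N_i = i!·e^i·Σ_λ C((q+1)/e, L)·L!·Π_{j≥2} (B_j/j!)^{λ_j}/(λ_j)!, the sum being over all tuples of nonnegative integers λ = (λ_2, λ_3, …) with Σ_{j≥2} j·λ_j = i, L = Σ_{j≥2} λ_j and B_j = q^{−1}(q−1)^j + (−1)^j(1 − q^{−1}). Equivalently, the frequency vector μ = (μ_0, …, μ_{2t})^T equals (M_t^{(1)})^{−1}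 b, where M_t^{(1)} is the (2t+1)×(2t+1) Vandermonde matrix with (i,j) entry (jeq − q − 1)^i and b_i = q^{2t+1}N_i − (q²−1)^i. -/
open Matrix

theorem coeff_prod_eq_sum_piAntidiag {ι : Type*} [DecidableEq ι] (W : Finset ι)
    (f : ι → PowerSeries ℚ) (i : ℕ) :
    PowerSeries.coeff i (∏ w ∈ W, f w) =
      ∑ k ∈ W.piAntidiag i, ∏ w ∈ W, PowerSeries.coeff (k w) (f w) := by
  rw [PowerSeries.coeff_prod]
  refine Finset.sum_bij (fun l _ => ⇑l) ?_ ?_ ?_ ?_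
  · intro l hl
    rw [Finset.mem_finsuppAntidiag] at hl
    rw [Finset.mem_piAntidiag]
    exact ⟨hl.1, fun w hw => hl.2 (by simpa using hw)⟩
  · intro a _ b _ hab
    exact DFunLike.coe_injective hab
  · intro k hk
    rw [Finset.mem_piAntidiag] at hk
    refine ⟨Finsupp.onFinset W k hk.2, ?_, rfl⟩
    rw [Finset.mem_finsuppAntidiag]
    exact ⟨hk.1, Finsupp.support_onFinset_subset⟩
  · intro l _
    rfl

theorem sum_piAntidiag_prod_eq_sum_multiplicities {ι : Type*} [DecidableEq ι] (W : Finset ι)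
    (b : ℕ → ℚ) (h0 : b 0 = 1) (h1 : b 1 = 0) (i : ℕ) :
    ∑ k ∈ W.piAntidiag i, ∏ w ∈ W, b (k w) =
      ∑ fl ∈ Finset.univ.filter (fun fl : Fin (i + 1) → Fin (i + 1) =>
          (∀ j : Fin (i + 1), (j : ℕ) < 2 → fl j = 0) ∧
          ∑ j : Fin (i + 1), (j : ℕ) * (fl j : ℕ) = i),
        (W.card.choose (∑ j, (fl j : ℕ)) : ℚ) * ((∑ j, (fl j : ℕ)).factorial : ℚ) *
          ∏ j : Fin (i + 1), b j ^ (fl j : ℕ) / ((fl j : ℕ).factorial : ℚ) := by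
  set s : Finset (Fin (i + 1)) := Finset.univ.filter fun j => 2 ≤ (j : ℕ) with hs
  set Q : PowerSeries ℚ := ∑ j ∈ s, PowerSeries.monomial (j : ℕ) (b j) with hQ
  have hcoeff : ∀ l ≤ i, PowerSeries.coeff l (Q + 1) = b l := by
    intro l hl
    rw [hQ, map_add, map_sum]
    simp only [PowerSeries.coeff_monomial, PowerSeries.coeff_one]
    by_cases h2 : 2 ≤ l
    · rw [Finset.sum_eq_single ⟨l, by omega⟩]
      · simp; omega
      · intro j _ hj
        rw [if_neg]
        rintro rfl
        exact hj rfl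
      · intro hn
        simp [hs, h2] at hn
    · rw [Finset.sum_eq_zero]
      · interval_cases l <;> simp [h0, h1]
      · intro j hj
        rw [if_neg]
        simp [hs] at hj
        omega
  have hL : ∑ k ∈ W.piAntidiag i, ∏ w ∈ W, b (k w) = PowerSeries.coeff i ((Q + 1) ^ W.card) := by
    rw [← Finset.prod_const, coeff_prod_eq_sum_piAntidiag]
    refine Finset.sum_congr rfl fun k hk => Finset.prod_congr rfl fun w hw => ?_
    rw [Finset.mem_piAntidiag] at hk
    rw [hcoeff]
    rw [← hk.1]
    exact Finset.single_le_sum (f := k) (fun _ _ => Nat.zero_le _) hw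
  have hterm : ∀ L, PowerSeries.coeff i (Q ^ L) =
      ∑ k ∈ (s.piAntidiag L).filter
          (fun k : Fin (i + 1) → ℕ => ∑ j : Fin (i + 1), (j : ℕ) * k j = i),
        (L.factorial : ℚ) * ∏ j : Fin (i + 1), b j ^ k j / ((k j).factorial : ℚ) := by
    intro L
    rw [hQ, Finset.sum_pow_eq_sum_piAntidiag, map_sum, Finset.sum_filter]
    refine Finset.sum_congr rfl fun k hk => ?_
    rw [Finset.mem_piAntidiag] at hk
    have hz : ∀ j ∉ s, k j = 0 := fun j hj => by
      by_contra hne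
      exact hj (hk.2 j hne)
    have hmon : (∏ j ∈ s, (PowerSeries.monomial (j : ℕ) (b j)) ^ k j : PowerSeries ℚ) =
        PowerSeries.monomial (∑ j : Fin (i + 1), (j : ℕ) * k j)
          (∏ j : Fin (i + 1), b j ^ k j) := by
      rw [Finset.prod_subset (Finset.subset_univ s)
        (fun j _ hj => by rw [hz j hj, pow_zero])]
      simp only [PowerSeries.monomial_pow, PowerSeries.prod_monomial, mul_comm]
    have hmult : (Nat.multinomial s k : ℚ) =
        L.factorial * ∏ j : Fin (i + 1), (1 / ((k j).factorial : ℚ)) := by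
      have := Nat.multinomial_spec s k
      rw [hk.1, Finset.prod_subset (Finset.subset_univ s)
        (fun j _ hj => by rw [hz j hj, Nat.factorial_zero])] at this
      rw [← this, Nat.cast_mul, mul_right_comm, Nat.cast_prod, ← Finset.prod_mul_distrib,
        Finset.prod_eq_one, one_mul]
      intro j _
      have : ((k j).factorial : ℚ) ≠ 0 := by positivity
      field_simp
    rw [hmon, ← nsmul_eq_mul, map_nsmul, PowerSeries.coeff_monomial, nsmul_eq_mul, hmult,
      mul_ite, mul_zero, mul_assoc, ← Finset.prod_mul_distrib]
    refine if_congr eq_comm (congrArg _ (Finset.prod_congr rfl fun j _ => ?_)) rfl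
    rw [one_div_mul_eq_div]
  rw [hL, add_pow, map_sum]
  simp only [one_pow, mul_one]
  rw [← Finset.sum_filter_of_ne (p := fun fl : Fin (i + 1) → Fin (i + 1) =>
    ∑ j, (fl j : ℕ) ∈ Finset.range (W.card + 1))]
  swap
  · intro fl _ hne
    rw [Finset.mem_range, Nat.lt_succ_iff]
    by_contra hlt
    rw [Nat.choose_eq_zero_of_lt (not_le.mp hlt)] at hne
    simp at hne
  rw [← Finset.sum_fiberwise_of_maps_to (t := Finset.range (W.card + 1))
    (g := fun fl : Fin (i + 1) → Fin (i + 1) => ∑ j, (fl j : ℕ))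
    (fun fl hfl => (Finset.mem_filter.mp hfl).2)]
  refine Finset.sum_congr rfl fun L hLmem => ?_
  rw [mul_comm, ← nsmul_eq_mul, map_nsmul, hterm, nsmul_eq_mul, Finset.mul_sum]
  symm
  refine Finset.sum_bij (fun fl _ j => (fl j : ℕ)) ?_ ?_ ?_ ?_
  · intro fl hfl
    simp only [Finset.mem_filter, Finset.mem_univ, true_and] at hfl
    obtain ⟨⟨⟨hlow, hsum⟩, -⟩, hfL⟩ := hfl
    rw [Finset.mem_filter, Finset.mem_piAntidiag]
    refine ⟨⟨?_, ?_⟩, hsum⟩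
    · rw [← hfL]
      refine Finset.sum_subset (Finset.subset_univ s) fun j _ hj => ?_
      rw [hlow j (by simpa [hs] using hj)]
      rfl
    · intro j hj
      simp only [hs, Finset.mem_filter, Finset.mem_univ, true_and]
      by_contra hlt
      rw [hlow j (not_le.mp hlt)] at hj
      exact hj rfl
  · intro a _ a' _ haa
    funext j
    exact Fin.ext (congrFun haa j)
  · intro k hk
    rw [Finset.mem_filter, Finset.mem_piAntidiag] at hk
    obtain ⟨⟨hkL, hks⟩, hsum⟩ := hk
    have hz : ∀ j ∉ s, k j = 0 := fun j hj => by
      by_contra hne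
      exact hj (hks j hne)
    have hlt : ∀ j, k j < i + 1 := by
      intro j
      by_cases hj : j ∈ s
      · have h2 : 2 ≤ (j : ℕ) := by simpa [hs] using hj
        have := Finset.single_le_sum (f := fun j : Fin (i + 1) => (j : ℕ) * k j)
          (fun _ _ => Nat.zero_le _) (Finset.mem_univ j)
        simp only [hsum] at this
        nlinarith
      · rw [hz j hj]
        omega
    refine ⟨fun j => ⟨k j, hlt j⟩, ?_, rfl⟩
    have hsumL : ∑ j, k j = L := by
      rw [← hkL]
      exact (Finset.sum_subset (Finset.subset_univ s) fun j _ hj => hz j hj).symm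
    simp only [Finset.mem_filter, Finset.mem_univ, true_and, hsumL, hLmem, and_true]
    refine ⟨fun j hj => Fin.ext (hz j ?_), hsum⟩
    simpa [hs] using hj
  · intro fl hfl
    rw [(Finset.mem_filter.mp hfl).2, mul_assoc]

theorem sum_pow_sum_eq_of_bijective {A K ι : Type*} [Fintype A] [Fintype K] [Nonempty K]
    [DecidableEq ι] (W : Finset ι) (ev : ι → A → K) (T : ℕ) (hT : T ≤ W.card)
    (hev : ∀ S ⊆ W, S.card = T → Function.Bijective fun (a : A) (w : S) => ev w a)
    (x : K → ℚ) (i : ℕ) (hi : i ≤ T) :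
    ∑ a, (∑ w ∈ W, x (ev w a)) ^ i =
      (Fintype.card K : ℚ) ^ T * ((i.factorial : ℚ) * ∑ k ∈ W.piAntidiag i,
        ∏ w ∈ W, ((∑ u, x u ^ k w) / Fintype.card K) / ((k w).factorial : ℚ)) := by
  have hK : (Fintype.card K : ℚ) ≠ 0 := by
    exact_mod_cast Fintype.card_ne_zero
  simp only [Finset.sum_pow_eq_sum_piAntidiag]
  rw [Finset.sum_comm, Finset.mul_sum, Finset.mul_sum]
  refine Finset.sum_congr rfl fun k hk => ?_
  rw [Finset.mem_piAntidiag] at hk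
  have hmult : (Nat.multinomial W k : ℚ) * ∏ w ∈ W, ((k w).factorial : ℚ) = i.factorial := by
    rw [← hk.1, ← Nat.multinomial_spec W k]
    push_cast
    ring
  obtain ⟨S, hsub, hSW, hcard⟩ := Finset.exists_subsuperset_card_eq
    (s := W.filter fun w => k w ≠ 0) (t := W) (n := T) (Finset.filter_subset _ _)
    (by
      refine le_trans ?_ hi
      rw [← hk.1, Finset.card_eq_sum_ones]
      refine (Finset.sum_le_sum fun w hw => ?_).trans
        (Finset.sum_le_sum_of_subset (Finset.filter_subset _ _))
      exact Nat.one_le_iff_ne_zero.mpr (Finset.mem_filter.mp hw).2) hT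
  have hz : ∀ w ∈ W, w ∉ S → k w = 0 := fun w hw hwS => by
    by_contra hne
    exact hwS (hsub (Finset.mem_filter.mpr ⟨hw, hne⟩))
  have hind : ∑ a, ∏ w ∈ W, x (ev w a) ^ k w = ∏ w ∈ S, ∑ u, x u ^ k w := by
    have h1 : ∀ a, ∏ w ∈ W, x (ev w a) ^ k w = ∏ w : S, x (ev w a) ^ k w := fun a => by
      rw [Finset.prod_coe_sort S (fun w => x (ev w a) ^ k w)]
      exact (Finset.prod_subset hSW fun w hw hwS => by rw [hz w hw hwS, pow_zero]).symm
    simp only [h1]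
    rw [← Finset.prod_coe_sort S (fun w => ∑ u, x u ^ k w), Finset.prod_univ_sum,
      Fintype.piFinset_univ]
    exact (hev S hSW hcard).sum_comp (fun v : S → K => ∏ w : S, x (v w) ^ k w)
  have hB : ∏ w ∈ W, (∑ u, x u ^ k w) / (Fintype.card K : ℚ) =
      (∏ w ∈ S, ∑ u, x u ^ k w) / (Fintype.card K : ℚ) ^ T := by
    rw [← Finset.prod_subset hSW fun w hw hwS => ?_]
    · rw [Finset.prod_div_distrib, Finset.prod_const, hcard]
    · rw [hz w hw hwS]
      simp [hK]
  have hfac : ∏ w ∈ W, ((k w).factorial : ℚ) ≠ 0 :=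
    Finset.prod_ne_zero_iff.mpr fun w _ => by positivity
  rw [← Finset.mul_sum, hind, Finset.prod_div_distrib, hB, ← hmult]
  field_simp

theorem two_mul_card_units_trace_ne_zero (K : Type*) [Field K] [Fintype K] [DecidableEq K]
    [Algebra (ZMod 2) K] (b : K) :
    2 * (∑ y : Kˣ, if Algebra.trace (ZMod 2) K (y * b) ≠ 0 then 1 else 0) =
      if b ≠ 0 then Fintype.card K else 0 := by
  by_cases hb : b = 0
  · simp [hb]
  rw [if_pos hb]
  obtain ⟨z, hz⟩ := Algebra.trace_surjective (ZMod 2) K 1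
  set f : K → ℕ := fun y => if Algebra.trace (ZMod 2) K y ≠ 0 then 1 else 0 with hf
  have hunits : (∑ y : Kˣ, f (y * b)) = ∑ y : K, f (y * b) := by
    rw [← Fintype.sum_subtype_add_sum_subtype (fun y : K => y ≠ 0) (fun y => f (y * b)),
      ← unitsEquivNeZero.sum_comp]
    simp only [unitsEquivNeZero_apply_coe, left_eq_add]
    refine Finset.sum_eq_zero fun y _ => ?_
    have hy : (y : K) = 0 := not_not.mp y.2
    simp [hf, hy]
  have hmul : ∑ y : K, f (y * b) = ∑ y : K, f y :=
    Equiv.sum_comp (Equiv.mulRight₀ b hb) f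
  have hadd : ∑ y : K, f (y + z) = ∑ y : K, f y :=
    Equiv.sum_comp (Equiv.addRight z) f
  have hpair : ∀ y : K, f y + f (y + z) = 1 := by
    intro y
    simp only [hf, map_add, hz]
    generalize Algebra.trace (ZMod 2) K y = v
    revert v
    decide
  calc 2 * ∑ y : Kˣ, f (y * b) = ∑ y : K, f y + ∑ y : K, f (y + z) := by
        rw [hadd, hunits, hmul, two_mul]
    _ = Fintype.card K := by
        rw [← Finset.sum_add_distrib]
        simp [hpair]

theorem sum_range_mul_orderOf {G : Type*} [Group G] (g : G) (f : G → ℕ) (e : ℕ) :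
    ∑ i ∈ Finset.range (e * orderOf g), f (g ^ i) =
      e * ∑ i ∈ Finset.range (orderOf g), f (g ^ i) := by
  induction e with
  | zero => simp
  | succ e ih =>
    rw [Nat.succ_mul, Finset.sum_range_add, ih, Nat.succ_mul]
    congr 1
    refine Finset.sum_congr rfl fun i _ => ?_
    rw [pow_add, mul_comm e, pow_mul, pow_orderOf_eq_one, one_pow, one_mul]

theorem card_image_pow_range_orderOf {G : Type*} [Group G] [DecidableEq G] (g : G) :
    ((Finset.range (orderOf g)).image (g ^ ·)).card = orderOf g := by
  rw [Finset.card_image_of_injOn, Finset.card_range]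
  simpa using pow_injOn_Iio_orderOf

theorem sum_range_orderOf_prodMk {G H : Type*} [Group G] [Group H] [DecidableEq G]
    [DecidableEq H] (x : G) (y : H) (hcop : (orderOf x).Coprime (orderOf y))
    (f : G × H → ℕ) :
    ∑ i ∈ Finset.range (orderOf (x, y)), f ((x, y) ^ i) =
      ∑ a ∈ (Finset.range (orderOf x)).image (x ^ ·),
        ∑ b ∈ (Finset.range (orderOf y)).image (y ^ ·), f (a, b) := by
  rcases Nat.eq_zero_or_pos (orderOf x) with hx | hx
  · simp [Prod.orderOf_mk, hx]
  rcases Nat.eq_zero_or_pos (orderOf y) with hy | hy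
  · simp [Prod.orderOf_mk, hy]
  rw [← Finset.sum_product', ← Finset.sum_image (f := f) (g := ((x, y) ^ ·))
    (by simpa using pow_injOn_Iio_orderOf (x := (x, y)))]
  congr 1
  refine Finset.eq_of_subset_of_card_le ?_ ?_
  · intro p hp
    obtain ⟨i, -, rfl⟩ := Finset.mem_image.mp hp
    simp only [Prod.pow_mk, Finset.mem_product, Finset.mem_image, Finset.mem_range]
    exact ⟨⟨i % orderOf x, Nat.mod_lt _ hx, pow_mod_orderOf _ _⟩,
      ⟨i % orderOf y, Nat.mod_lt _ hy, pow_mod_orderOf _ _⟩⟩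
  · rw [Finset.card_product, card_image_pow_range_orderOf, card_image_pow_range_orderOf,
      card_image_pow_range_orderOf, Prod.orderOf_mk, hcop.lcm_eq_mul]

theorem gcd_sq_sub_one_eq (q e h d Δ : ℕ) (hq : 2 ≤ q) (he : e = Nat.gcd h (q + 1))
   (hΔ : Nat.gcd Δ (q - 1) = 1) (hd : (d : ℤ) ≡ Δ [ZMOD ((q : ℤ) - 1)]) (hd' : (q + 1) ∣ d) :
    (q ^ 2 - 1).gcd d = q + 1 ∧ (q ^ 2 - 1).gcd ((q - 1) * h) = (q - 1) * e := by
  have h1 : q ^ 2 - 1 = (q + 1) * (q - 1) := by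
    simpa using Nat.sq_sub_sq q 1
  constructor
  · obtain ⟨k, rfl⟩ := hd'
    rw [h1, Nat.gcd_mul_left]
    have : Nat.gcd (q - 1) k = 1 := by
      have hdvd : Nat.gcd (q - 1) k ∣ Δ := by
        have h3 : ((Nat.gcd (q - 1) k : ℕ) : ℤ) ∣ (q : ℤ) - 1 := by
          have := Int.natCast_dvd_natCast.mpr (Nat.gcd_dvd_left (q - 1) k)
          rwa [Nat.cast_sub (by omega), Nat.cast_one] at this
        have h4 : ((Nat.gcd (q - 1) k : ℕ) : ℤ) ∣ ((q + 1) * k : ℕ) :=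
          Int.natCast_dvd_natCast.mpr ((Nat.gcd_dvd_right (q - 1) k).mul_left _)
        have h5 := (h3.trans hd.dvd)
        have := (dvd_add h5 h4)
        rw [sub_add_cancel] at this
        exact Int.natCast_dvd_natCast.mp this
      have := Nat.dvd_gcd hdvd (Nat.gcd_dvd_left (q - 1) k)
      rw [hΔ] at this
      exact Nat.dvd_one.mp this
    rw [this, mul_one]
  · rw [h1, mul_comm (q + 1), Nat.gcd_mul_left, he, Nat.gcd_comm]

/-- Evaluation at `w` of the `K`-valued trace function with coefficients `a`. -/
noncomputable def traceEval {K F : Type*} [Field K] [Field F] [Algebra K F] {t : ℕ}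
    (a : K × (Fin t → F)) (w : F) : K :=
  a.1 + Algebra.trace K F (∑ j : Fin t, a.2 j * w ^ ((j : ℕ) + 1))

theorem traceEval_sub {K F : Type*} [Field K] [Field F] [Algebra K F] {t : ℕ}
    (a a' : K × (Fin t → F)) (w : F) :
    traceEval (a - a') w = traceEval a w - traceEval a' w := by
  simp only [traceEval, Prod.fst_sub, Prod.snd_sub, Pi.sub_apply, sub_mul,
    Finset.sum_sub_distrib, map_sub]
  ring

theorem trace_mul_traceEval {k K F : Type*} [Field k] [Field K] [Field F] [Algebra k K]
    [Algebra k F] [Algebra K F] [IsScalarTower k K F] [FiniteDimensional k K]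
    [FiniteDimensional K F] {t : ℕ} (a : K × (Fin t → F)) (y : K) (w : F) :
    Algebra.trace k K (y * traceEval a w) = Algebra.trace k K (a.1 * y) +
      Algebra.trace k F (∑ j : Fin t, a.2 j * (algebraMap K F y * w ^ ((j : ℕ) + 1))) := by
  rw [← Algebra.trace_trace (R := k) (S := K) (T := F), ← map_add, traceEval, mul_add,
    mul_comm y a.1, ← smul_eq_mul y (Algebra.trace K F _), ← map_smul, Finset.smul_sum]
  simp only [Algebra.smul_def, mul_left_comm]

theorem eq_zero_of_traceEval_eq_zero {K F : Type*} [Field K] [Fintype K] [Field F] [Fintype F]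
    [Algebra K F] (hrank : Module.finrank K F = 2) {t : ℕ} (a : K × (Fin t → F))
    (S : Finset F) (hS : ∀ w ∈ S, w ^ (Fintype.card K + 1) = 1) (hcard : 2 * t < S.card)
    (hzero : ∀ w ∈ S, traceEval a w = 0) : a = 0 := by
  classical
  set q := Fintype.card K with hq
  set P : Polynomial F := Polynomial.C (algebraMap K F a.1) * Polynomial.X ^ t +
    ∑ j : Fin t, (Polynomial.C (a.2 j) * Polynomial.X ^ (t + (j + 1)) +
      Polynomial.C (a.2 j ^ q) * Polynomial.X ^ (t - (j + 1))) with hP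
  have hdeg : P.natDegree ≤ 2 * t := by
    refine Polynomial.natDegree_add_le_of_degree_le
      ((Polynomial.natDegree_C_mul_X_pow_le _ _).trans (by omega))
      (Polynomial.natDegree_sum_le_of_forall_le _ _ fun j _ => ?_)
    have := j.2
    exact Polynomial.natDegree_add_le_of_degree_le
      ((Polynomial.natDegree_C_mul_X_pow_le _ _).trans (by omega))
      ((Polynomial.natDegree_C_mul_X_pow_le _ _).trans (by omega))
  have heval : ∀ w ∈ S, P.eval w = 0 := by
    intro w hw
    have hwq : w ^ q * w = 1 := by rw [← pow_succ, hS w hw]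
    have h1 : algebraMap K F (traceEval a w) = 0 := by rw [hzero w hw, map_zero]
    rw [traceEval, map_add, FiniteField.algebraMap_trace_eq_sum_pow, hrank,
      Finset.sum_range_succ, Finset.sum_range_one, pow_zero, pow_one, pow_one,
      Nat.card_eq_fintype_card, ← hq] at h1
    have hfrob : (∑ j : Fin t, a.2 j * w ^ ((j : ℕ) + 1)) ^ q =
        ∑ j : Fin t, (a.2 j * w ^ ((j : ℕ) + 1)) ^ q := by
      have := map_sum (FiniteField.frobeniusAlgHom K F)
        (fun j : Fin t => a.2 j * w ^ ((j : ℕ) + 1)) Finset.univ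
      simpa only [FiniteField.coe_frobeniusAlgHom] using this
    rw [hfrob, ← Finset.sum_add_distrib] at h1
    rw [hP, Polynomial.eval_add, Polynomial.eval_finsetSum]
    simp only [Polynomial.eval_add, Polynomial.eval_mul, Polynomial.eval_C, Polynomial.eval_pow,
      Polynomial.eval_X]
    calc _ = w ^ t * (algebraMap K F a.1 + ∑ j : Fin t, (a.2 j * w ^ ((j : ℕ) + 1) +
          (a.2 j * w ^ ((j : ℕ) + 1)) ^ q)) := by
          rw [mul_add, Finset.mul_sum, mul_comm]
          congr 1
          refine Finset.sum_congr rfl fun j _ => ?_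
          have hsplit : w ^ t = w ^ (t - ((j : ℕ) + 1)) * w ^ ((j : ℕ) + 1) := by
            rw [← pow_add]
            congr 1
            have := j.2
            omega
          have hone : w ^ ((j : ℕ) + 1) * (w ^ ((j : ℕ) + 1)) ^ q = 1 := by
            rw [← pow_mul, mul_comm ((j : ℕ) + 1) q, pow_mul, ← mul_pow, mul_comm, hwq, one_pow]
          rw [mul_add, mul_pow, pow_add]
          congr 1
          · ring
          · rw [hsplit]
            linear_combination (-(a.2 j ^ q) * w ^ (t - ((j : ℕ) + 1))) * hone
      _ = 0 := by rw [h1, mul_zero]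
  have hP0 : P = 0 :=
    Polynomial.eq_zero_of_natDegree_lt_card_of_eval_eq_zero' P S heval (by omega)
  have hcoeff : ∀ k, (if k = t then algebraMap K F a.1 else 0) +
      ∑ j : Fin t, ((if k = t + ((j : ℕ) + 1) then a.2 j else 0) +
        (if k = t - ((j : ℕ) + 1) then a.2 j ^ q else 0)) = 0 := by
    intro k
    have := congrArg (fun p => Polynomial.coeff p k) hP0
    simpa only [hP, Polynomial.coeff_add, Polynomial.finsetSum_coeff,
      Polynomial.coeff_C_mul_X_pow, Polynomial.coeff_zero] using this
  refine Prod.ext ?_ (funext fun j₀ => ?_)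
  · have := hcoeff t
    rw [if_pos rfl, Finset.sum_eq_zero, add_zero] at this
    · exact (map_eq_zero _).mp this
    · intro j _
      have := j.2
      rw [if_neg (by omega), if_neg (by omega), add_zero]
  · have := hcoeff (t + ((j₀ : ℕ) + 1))
    rw [if_neg (by omega), zero_add, Finset.sum_eq_single j₀] at this
    · rw [if_pos rfl, if_neg (by omega), add_zero] at this
      exact this
    · intro j _ hj
      have := Fin.val_ne_of_ne hj
      rw [if_neg (by omega), if_neg (by omega), add_zero]
    · simp

theorem two_mul_hammingNorm_eq (q : ℕ) (hq2 : 2 ≤ q) (hqe : Even q)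
    (K F : Type*) [Field K] [Fintype K] [DecidableEq K] [Field F] [Fintype F]
    [Algebra (ZMod 2) K] [Algebra (ZMod 2) F] [Algebra K F] [IsScalarTower (ZMod 2) K F]
    (hK : Fintype.card K = q) (hF : Fintype.card F = q ^ 2)
    (γ : Fˣ) (hγ : ∀ x : Fˣ, x ∈ Subgroup.zpowers γ)
    (h Δ e d₀ t : ℕ) (hΔ : Nat.gcd Δ (q - 1) = 1) (he : e = Nat.gcd h (q + 1))
    (hd₀ : (d₀ : ℤ) ≡ Δ [ZMOD ((q : ℤ) - 1)]) (hd₀' : (q + 1) ∣ d₀)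
    (d : ℕ → ℕ) (hd : ∀ j ≤ t, d j ≡ d₀ + (q - 1) * h * j [MOD q ^ 2 - 1])
    (g₀ : K) (hg₀ : algebraMap K F g₀ = (γ : F) ^ d₀)
    (c : K × (Fin t → F) → Fin (q ^ 2 - 1) → ZMod 2)
    (hc : ∀ a i, c a i =
      Algebra.trace (ZMod 2) K (a.1 * g₀ ^ (i : ℕ)) +
      Algebra.trace (ZMod 2) F
        (∑ j : Fin t, a.2 j * (γ : F) ^ (d ((j : ℕ) + 1) * (i : ℕ)))) :
    ∃ W : Finset Fˣ, W.card = (q + 1) / e ∧ (∀ w ∈ W, w ^ (q + 1) = 1) ∧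
      ∀ a, 2 * hammingNorm (c a) =
        e * (q * ∑ w ∈ W, if traceEval a (w : F) ≠ 0 then 1 else 0) := by
  classical
  have hfact : q ^ 2 - 1 = (q + 1) * (q - 1) := by
    simpa using Nat.sq_sub_sq q 1
  have hepos : 0 < e := he ▸ Nat.gcd_pos_of_pos_right _ (Nat.succ_pos q)
  have hedvd : e ∣ q + 1 := he ▸ Nat.gcd_dvd_right _ _
  have hγord : orderOf γ = q ^ 2 - 1 := by
    rw [orderOf_eq_card_of_forall_mem_zpowers hγ, Nat.card_units, Nat.card_eq_fintype_card, hF]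
  obtain ⟨hgcd₀, hgcdβ⟩ := gcd_sq_sub_one_eq q e h d₀ Δ hq2 he hΔ hd₀ hd₀'
  have hg₀ne : g₀ ≠ 0 := by
    rintro rfl
    rw [map_zero] at hg₀
    exact pow_ne_zero _ γ.ne_zero hg₀.symm
  set u : Kˣ := Units.mk0 g₀ hg₀ne with hu
  set β : Fˣ := γ ^ ((q - 1) * h) with hβ
  have hmapu : Units.map (algebraMap K F : K →* F) u = γ ^ d₀ := by
    ext
    exact hg₀
  have huord : orderOf u = q - 1 := by
    rw [← orderOf_injective (Units.map (algebraMap K F : K →* F))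
      (Units.map_injective (algebraMap K F).injective), hmapu, orderOf_pow, hγord, hgcd₀, hfact,
      Nat.mul_div_cancel_left _ (Nat.succ_pos q)]
  have hβord : orderOf β = (q + 1) / e := by
    rw [hβ, orderOf_pow, hγord, hgcdβ, hfact, mul_comm (q + 1),
      Nat.mul_div_mul_left _ _ (by omega)]
  have hcop : (orderOf u).Coprime (orderOf β) := by
    rw [huord, hβord]
    refine Nat.Coprime.coprime_dvd_right (Nat.div_dvd_of_dvd hedvd) ?_
    have h1 : q + 1 = (q - 1) + 2 := by omega
    rw [h1, Nat.coprime_self_add_right, Nat.coprime_two_right]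
    obtain ⟨r, hr⟩ := hqe
    exact ⟨r - 1, by omega⟩
  have hlen : q ^ 2 - 1 = e * orderOf (u, β) := by
    rw [Prod.orderOf_mk, hcop.lcm_eq_mul, huord, hβord, hfact, mul_left_comm,
      Nat.mul_div_cancel' hedvd, mul_comm]
  have himage : (Finset.range (orderOf u)).image (u ^ ·) = Finset.univ := by
    rw [← Finset.card_eq_iff_eq_univ, card_image_pow_range_orderOf, huord,
      Fintype.card_units, hK]
  refine ⟨(Finset.range (orderOf β)).image (β ^ ·), ?_, ?_, ?_⟩
  · rw [card_image_pow_range_orderOf, hβord]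
  · intro w hw
    obtain ⟨i, -, rfl⟩ := Finset.mem_image.mp hw
    have : β ^ (q + 1) = 1 :=
      orderOf_dvd_iff_pow_eq_one.mp (hβord ▸ Nat.div_dvd_of_dvd hedvd)
    rw [← pow_mul, mul_comm, pow_mul, this, one_pow]
  intro a
  set G : Kˣ × Fˣ → ℕ := fun p =>
    if Algebra.trace (ZMod 2) K ((p.1 : K) * traceEval a (p.2 : F)) ≠ 0 then 1 else 0 with hG
  have hcoord : ∀ i : Fin (q ^ 2 - 1),
      c a i = Algebra.trace (ZMod 2) K (((u ^ (i : ℕ) : Kˣ) : K) *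
        traceEval a ((β ^ (i : ℕ) : Fˣ) : F)) := by
    intro i
    rw [hc, trace_mul_traceEval]
    congr 2
    refine Finset.sum_congr rfl fun j _ => ?_
    congr 1
    have hpow : γ ^ d ((j : ℕ) + 1) = γ ^ d₀ * β ^ ((j : ℕ) + 1) := by
      rw [hβ, ← pow_mul, ← pow_add, pow_eq_pow_iff_modEq, hγord]
      exact hd _ j.2
    have := congrArg (fun x : Fˣ => ((x ^ (i : ℕ) : Fˣ) : F)) hpow
    simp only [Units.val_pow_eq_pow_val, Units.val_mul, mul_pow] at this
    rw [pow_mul, this]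
    simp only [hu, Units.val_pow_eq_pow_val, Units.val_mk0, map_pow, hg₀]
    rw [pow_right_comm (β : F)]
  have hham : hammingNorm (c a) =
      ∑ i ∈ Finset.range (e * orderOf (u, β)), G ((u, β) ^ i) := by
    rw [← hlen, hammingNorm, Finset.card_filter,
      ← Fin.sum_univ_eq_sum_range (fun i => G ((u, β) ^ i))]
    exact Finset.sum_congr rfl fun i _ => by simp only [hG, hcoord, Prod.pow_mk]
  rw [hham, sum_range_mul_orderOf, sum_range_orderOf_prodMk u β hcop, himage,
    Finset.sum_comm, mul_left_comm]
  congr 1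
  rw [Finset.mul_sum, Finset.mul_sum]
  refine Finset.sum_congr rfl fun w _ => ?_
  refine (two_mul_card_units_trace_ne_zero K (traceEval a (w : F))).trans ?_
  rw [hK, mul_ite, mul_one, mul_zero]

theorem bijective_traceEval {K F : Type*} [Field K] [Fintype K] [Field F] [Fintype F]
    [Algebra K F] (hrank : Module.finrank K F = 2) {t : ℕ} (S : Finset Fˣ)
    (hS : ∀ w ∈ S, w ^ (Fintype.card K + 1) = 1) (hcard : S.card = 2 * t + 1) :
    Function.Bijective fun (a : K × (Fin t → F)) (w : S) => traceEval a ((w : Fˣ) : F) := by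
  classical
  rw [Fintype.bijective_iff_injective_and_card]
  constructor
  · intro a a' haa
    refine sub_eq_zero.mp (eq_zero_of_traceEval_eq_zero hrank (a - a') (S.image Units.val) ?_ ?_ ?_)
    · simp only [Finset.forall_mem_image]
      intro w hw
      rw [← Units.val_pow_eq_pow_val, hS w hw, Units.val_one]
    · rw [Finset.card_image_of_injective _ Units.val_injective]
      omega
    · simp only [Finset.forall_mem_image]
      intro w hw
      rw [traceEval_sub, sub_eq_zero]
      exact congrFun haa ⟨w, hw⟩
  · rw [Fintype.card_prod, Fintype.card_fun, Fintype.card_fun, Fintype.card_fin,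
      Fintype.card_coe, hcard, Module.card_eq_pow_finrank (K := K) (V := F), hrank]
    ring

/-- Theorem 2(i): power-moment identities and weight distribution of the binary code
`C⁽¹⁾`.  With the setup of the paper, let `μ_j` be the number of nonzero messages `a` whose
codeword `c(a)` has Hamming weight `w_j = (q² - (je-1)q)/2`.  Then for all `0 ≤ i ≤ 2t`,
`∑_{j=0}^{2t} (jeq - q - 1)^i μ_j = q^{2t+1} N_i - (q²-1)^i`, where `N_0 = 1`, `N_1 = 0`
and for `i ≥ 2`, `N_i` is given by the explicit formula (2.7) of the paper; equivalently
`μ = (M_t^{(1)})⁻¹ b` with `M_t^{(1)}` the Vandermonde matrix with entries `(jeq-q-1)^i`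
and `b_i = q^{2t+1} N_i - (q²-1)^i`. -/
theorem stmt_16 (m : ℕ) (hm : 0 < m) (q : ℕ) (hq : q = 2 ^ m)
    (K F : Type*) [Field K] [Fintype K] [Field F] [Fintype F]
    [Algebra (ZMod 2) K] [Algebra (ZMod 2) F] [Algebra K F]
    [IsScalarTower (ZMod 2) K F]
    (hK : Fintype.card K = q) (hF : Fintype.card F = q ^ 2)
    (γ : Fˣ) (hγ : ∀ x : Fˣ, x ∈ Subgroup.zpowers γ)
    (h Δ : ℕ) (hh : 0 < h) (hΔpos : 0 < Δ)
    (hhq : ¬ (q + 1) ∣ h) (hΔ : Nat.gcd Δ (q - 1) = 1)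
    (e : ℕ) (he : e = Nat.gcd h (q + 1))
    (t : ℕ) (ht : 2 * e * t ≤ q + 1)
    (d : ℕ → ℕ) (s : ℕ → ℤ)
    (hdpos : ∀ j ≤ t, 0 < d j)
    (hs : ∀ j ≤ t, 2 * s j ≡ 2 * (j : ℤ) * h + Δ [ZMOD ((q : ℤ) + 1)])
    (hd : ∀ j ≤ t, (d j : ℤ) ≡ s j * ((q : ℤ) - 1) + Δ [ZMOD ((q : ℤ) ^ 2 - 1)])
    (g₀ : K) (hg₀ : algebraMap K F g₀ = (γ : F) ^ d 0)
    (c : K × (Fin t → F) → Fin (q ^ 2 - 1) → ZMod 2)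
    (hc : ∀ a i, c a i =
      Algebra.trace (ZMod 2) K (a.1 * g₀ ^ (i : ℕ)) +
      Algebra.trace (ZMod 2) F
        (∑ j : Fin t, a.2 j * (γ : F) ^ (d ((j : ℕ) + 1) * (i : ℕ))))
    (μ : ℕ → ℕ)
    (hμ : ∀ j, μ j = Nat.card {a : K × (Fin t → F) // a ≠ 0 ∧
      (2 * hammingNorm (c a) : ℤ) = (q : ℤ) ^ 2 - ((j : ℤ) * e - 1) * q})
    (N : ℕ → ℚ) (hN0 : N 0 = 1) (hN1 : N 1 = 0)
    (hN : ∀ i, 2 ≤ i → N i =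
      (i.factorial : ℚ) * (e : ℚ) ^ i *
        ∑ fl ∈ Finset.univ.filter (fun fl : Fin (i + 1) → Fin (i + 1) =>
            (∀ j : Fin (i + 1), (j : ℕ) < 2 → fl j = 0) ∧
            ∑ j : Fin (i + 1), (j : ℕ) * (fl j : ℕ) = i),
          (((q + 1) / e).choose (∑ j, (fl j : ℕ)) : ℚ) *
            ((∑ j, (fl j : ℕ)).factorial : ℚ) *
            ∏ j : Fin (i + 1),
              ((((q : ℚ) - 1) ^ (j : ℕ) / q + (-1) ^ (j : ℕ) * (1 - 1 / q)) /
                  ((j : ℕ).factorial : ℚ)) ^ (fl j : ℕ) /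
                ((fl j : ℕ).factorial : ℚ)) :
    (∀ i ≤ 2 * t,
      ∑ j ∈ Finset.range (2 * t + 1),
        ((j : ℚ) * e * q - q - 1) ^ i * (μ j : ℚ) =
          (q : ℚ) ^ (2 * t + 1) * N i - ((q : ℚ) ^ 2 - 1) ^ i) ∧
    (fun j : Fin (2 * t + 1) => (μ (j : ℕ) : ℚ)) =
      (Matrix.of fun i j : Fin (2 * t + 1) =>
          ((j : ℚ) * e * q - q - 1) ^ (i : ℕ))⁻¹ *ᵥ
        (fun i : Fin (2 * t + 1) =>
          (q : ℚ) ^ (2 * t + 1) * N (i : ℕ) - ((q : ℚ) ^ 2 - 1) ^ (i : ℕ)) := by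
  
  classical
  have hq2 : 2 ≤ q := by
    rw [hq]
    exact Nat.le_self_pow hm.ne' 2
  have hqe : Even q := by
    rw [hq]
    exact even_two.pow_of_ne_zero hm.ne'
  have hepos : 0 < e := he ▸ Nat.gcd_pos_of_pos_right _ (Nat.succ_pos q)
  have hedvd : e ∣ q + 1 := he ▸ Nat.gcd_dvd_right _ _
  set n := (q + 1) / e with hn
  have hen : e * n = q + 1 := Nat.mul_div_cancel' hedvd
  have htn : 2 * t + 1 ≤ n := by
    have h1 : 2 * t ≤ n := by
      refine Nat.le_of_mul_le_mul_left ?_ hepos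
      rw [hen]
      linarith
    refine Nat.lt_of_le_of_ne h1 fun h2 => ?_
    obtain ⟨r, hr⟩ := hqe
    have h3 : 2 * (e * t) = q + 1 := by
      rw [← hen, ← h2]
      ring
    omega
  have hrank : Module.finrank K F = 2 := by
    have := Module.card_eq_pow_finrank (K := K) (V := F)
    rw [hF, hK] at this
    exact (Nat.pow_right_injective hq2 this).symm
  have hsq : (q : ℤ) ^ 2 - 1 = (q + 1) * (q - 1) := by ring
  have hcop2 : IsCoprime ((q : ℤ) + 1) 2 := by
    obtain ⟨r, hr⟩ := hqe
    exact ⟨1, -r, by push_cast [hr]; ring⟩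
  have hd₀ : (d 0 : ℤ) ≡ Δ [ZMOD ((q : ℤ) - 1)] := by
    have h1 := (hd 0 (Nat.zero_le t)).of_dvd (Dvd.intro_left _ hsq.symm)
    refine h1.trans (Int.ModEq.symm ((Int.modEq_iff_dvd).mpr ⟨s 0, by ring⟩))
  have hd₀' : (q + 1) ∣ d 0 := by
    have h1 := ((hd 0 (Nat.zero_le t)).of_dvd (Dvd.intro _ hsq.symm)).dvd
    have h2 := (hs 0 (Nat.zero_le t)).dvd
    have h3 : ((q : ℤ) + 1) ∣ (d 0 : ℤ) := by
      obtain ⟨r₁, hr₁⟩ := h1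
      obtain ⟨r₂, hr₂⟩ := h2
      exact ⟨s 0 - r₁ + r₂, by push_cast at hr₂; linear_combination (-1 : ℤ) * hr₁ + hr₂⟩
    exact_mod_cast h3
  have hdmod : ∀ j ≤ t, d j ≡ d 0 + (q - 1) * h * j [MOD q ^ 2 - 1] := by
    intro j hj
    have h1 : ((q : ℤ) + 1) ∣ s j - s 0 - j * h := by
      refine hcop2.dvd_of_dvd_mul_left ?_
      obtain ⟨r₁, hr₁⟩ := (hs j hj).dvd
      obtain ⟨r₂, hr₂⟩ := (hs 0 (Nat.zero_le t)).dvd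
      exact ⟨r₂ - r₁, by push_cast at hr₂; linear_combination (-1 : ℤ) * hr₁ + hr₂⟩
    obtain ⟨r₀, hr₀⟩ := h1
    obtain ⟨r₁, hr₁⟩ := (hd j hj).dvd
    obtain ⟨r₂, hr₂⟩ := (hd 0 (Nat.zero_le t)).dvd
    rw [← Int.natCast_modEq_iff, Int.modEq_iff_dvd, Nat.cast_sub (Nat.one_le_pow _ _ (by omega))]
    push_cast [Nat.cast_sub (show 1 ≤ q by omega)]
    exact ⟨r₁ - r₂ - r₀, by linear_combination hr₁ - hr₂ - ((q : ℤ) - 1) * hr₀⟩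
  obtain ⟨W, hWcard, hWpow, hweight⟩ := two_mul_hammingNorm_eq q hq2 hqe K F hK hF γ hγ h Δ e
    (d 0) t hΔ he hd₀ hd₀' d hdmod g₀ hg₀ c hc
  rw [← hn] at hWcard
  rw [← hK] at hWpow
  set Z : K × (Fin t → F) → ℕ := fun a => (W.filter fun w : Fˣ => traceEval a (w : F) = 0).card with hZ
  have hZcompl : ∀ a, (∑ w ∈ W, if traceEval a (w : F) ≠ 0 then 1 else 0) + Z a = n := by
    intro a
    rw [hZ, ← Finset.card_filter, add_comm, ← hWcard]
    exact Finset.card_filter_add_card_filter_not fun w : Fˣ => traceEval a (w : F) = 0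
  have hZweight : ∀ a, (2 * hammingNorm (c a) : ℤ) = (q : ℤ) ^ 2 - ((Z a : ℤ) * e - 1) * q := by
    intro a
    have h1 := congrArg (Nat.cast (R := ℤ)) (hweight a)
    have h2 := congrArg (Nat.cast (R := ℤ)) (hZcompl a)
    have h3 := congrArg (Nat.cast (R := ℤ)) hen
    push_cast at h1 h2 h3
    linear_combination h1 + (e : ℤ) * q * h2 + q * h3
  have hμcard : ∀ j, μ j = (Finset.univ.filter fun a : K × (Fin t → F) => a ≠ 0 ∧ Z a = j).card := by
    intro j
    rw [hμ, Nat.card_eq_fintype_card, Fintype.card_subtype]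
    congr 1
    refine Finset.filter_congr fun a _ => and_congr_right fun _ => ?_
    rw [hZweight]
    have hq0 : (q : ℤ) ≠ 0 := by positivity
    have he0 : (e : ℤ) ≠ 0 := by positivity
    rw [sub_right_inj, mul_left_inj' hq0, sub_left_inj, mul_left_inj' he0, Nat.cast_inj]
  have hZle : ∀ a ≠ 0, Z a ≤ 2 * t := by
    intro a ha
    by_contra hlt
    refine ha (eq_zero_of_traceEval_eq_zero hrank a
      ((W.filter fun w : Fˣ => traceEval a (w : F) = 0).image Units.val) ?_ ?_ ?_)
    · simp only [Finset.forall_mem_image, Finset.mem_filter]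
      intro w hw
      rw [← Units.val_pow_eq_pow_val, hWpow w hw.1, Units.val_one]
    · rw [Finset.card_image_of_injective _ Units.val_injective]
      exact not_le.mp hlt
    · simp only [Finset.forall_mem_image, Finset.mem_filter]
      exact fun w hw => hw.2
  have hZzero : Z 0 = n := by
    rw [← hWcard, hZ]
    simp [traceEval]
  have henQ : (e : ℚ) * n = q + 1 := by exact_mod_cast hen
  have hqQ : (q : ℚ) ≠ 0 := by positivity
  set x : K → ℚ := fun u => if u = 0 then (q : ℚ) - 1 else -1 with hx
  have hxsum : ∀ a, (e : ℚ) * ∑ w ∈ W, x (traceEval a (w : F)) = (Z a : ℚ) * e * q - q - 1 := by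
    intro a
    have h1 : ∀ u, x u = (if u = 0 then (q : ℚ) else 0) - 1 := fun u => by
      simp only [hx]
      split_ifs <;> ring
    simp only [h1]
    rw [Finset.sum_sub_distrib, ← Finset.sum_filter, Finset.sum_const, Finset.sum_const, hWcard,
      nsmul_eq_mul, nsmul_eq_mul]
    linear_combination -henQ
  have hxmoment : ∀ j, (∑ u, x u ^ j) / (Fintype.card K : ℚ) =
      ((q : ℚ) - 1) ^ j / q + (-1) ^ j * (1 - 1 / q) := by
    intro j
    rw [hK, ← Finset.add_sum_erase _ _ (Finset.mem_univ (0 : K)),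
      Finset.sum_congr rfl (g := fun _ => (-1 : ℚ) ^ j)
        (fun u hu => by rw [hx]; simp only [if_neg (Finset.ne_of_mem_erase hu)]),
      Finset.sum_const, Finset.card_erase_of_mem (Finset.mem_univ _), Finset.card_univ, hK,
      nsmul_eq_mul, Nat.cast_sub (by omega), Nat.cast_one]
    simp only [hx, if_true]
    field_simp
  have hNall : ∀ i, N i = (e : ℚ) ^ i * ((i.factorial : ℚ) * ∑ k ∈ W.piAntidiag i,
      ∏ w ∈ W, ((∑ u, x u ^ k w) / (Fintype.card K : ℚ)) / ((k w).factorial : ℚ)) := by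
    intro i
    simp only [hxmoment]
    rw [sum_piAntidiag_prod_eq_sum_multiplicities W (fun j =>
      (((q : ℚ) - 1) ^ j / q + (-1) ^ j * (1 - 1 / q)) / (j.factorial : ℚ))
      (by simp) (by simp; field_simp; ring) i, hWcard]
    rcases lt_or_ge i 2 with hi | hi
    · interval_cases i
      · rw [hN0, Finset.filter_true_of_mem (by decide)]
        simp
      · rw [hN1, Finset.filter_false_of_mem (by decide)]
        simp
    · rw [hN i hi]
      ring
  have hmoment : ∀ i ≤ 2 * t,
      ∑ j ∈ Finset.range (2 * t + 1), ((j : ℚ) * e * q - q - 1) ^ i * (μ j : ℚ) =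
        (q : ℚ) ^ (2 * t + 1) * N i - ((q : ℚ) ^ 2 - 1) ^ i := by
    intro i hi
    have hfiber : ∑ j ∈ Finset.range (2 * t + 1), ((j : ℚ) * e * q - q - 1) ^ i * (μ j : ℚ) =
        ∑ a ∈ Finset.univ.erase 0, ((Z a : ℚ) * e * q - q - 1) ^ i := by
      rw [← Finset.sum_fiberwise_of_maps_to (t := Finset.range (2 * t + 1)) (g := Z)
        (fun a ha => Finset.mem_range.mpr (Nat.lt_succ_of_le (hZle a (Finset.ne_of_mem_erase ha))))]
      refine Finset.sum_congr rfl fun j _ => ?_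
      rw [Finset.sum_congr rfl (g := fun _ => ((j : ℚ) * e * q - q - 1) ^ i)
        (fun a ha => by rw [(Finset.mem_filter.mp ha).2]), Finset.sum_const, nsmul_eq_mul,
        mul_comm, hμcard]
      congr 3
      ext a
      simp
    have hfull := sum_pow_sum_eq_of_bijective W (fun w (a : K × (Fin t → F)) => traceEval a (w : F))
      (2 * t + 1) (hWcard ▸ htn)
      (fun S hS hcard => bijective_traceEval hrank S (fun w hw => hWpow w (hS hw)) hcard)
      x i (by omega)
    have hzero : ((Z 0 : ℚ) * e * q - q - 1) = (q : ℚ) ^ 2 - 1 := by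
      rw [hZzero]
      linear_combination (q : ℚ) * henQ
    rw [hfiber, eq_sub_iff_add_eq, ← hzero, Finset.sum_erase_add _ _ (Finset.mem_univ 0), hNall,
      mul_left_comm, ← hK, ← hfull, Finset.mul_sum]
    exact Finset.sum_congr rfl fun a _ => by rw [← mul_pow, hxsum, hK]
  refine ⟨hmoment, ?_⟩
  set v : Fin (2 * t + 1) → ℚ := fun j => (j : ℚ) * e * q - q - 1 with hv
  have hM : (Matrix.of fun i j : Fin (2 * t + 1) => ((j : ℚ) * e * q - q - 1) ^ (i : ℕ)) =
      (Matrix.vandermonde v)ᵀ := rfl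
  have hdet : IsUnit (Matrix.vandermonde v)ᵀ.det := by
    rw [Matrix.det_transpose, isUnit_iff_ne_zero, Matrix.det_vandermonde_ne_zero_iff]
    intro j j' hjj
    have heQ : (e : ℚ) ≠ 0 := by positivity
    simp only [hv, sub_left_inj, mul_left_inj' hqQ, mul_left_inj' heQ, Nat.cast_inj] at hjj
    exact Fin.ext hjj
  have hmul : (Matrix.vandermonde v)ᵀ *ᵥ (fun j : Fin (2 * t + 1) => (μ (j : ℕ) : ℚ)) =
      fun i : Fin (2 * t + 1) =>
        (q : ℚ) ^ (2 * t + 1) * N (i : ℕ) - ((q : ℚ) ^ 2 - 1) ^ (i : ℕ) := by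
    funext i
    rw [← hmoment i (Nat.lt_succ_iff.mp i.2), ← Fin.sum_univ_eq_sum_range
      (fun j : ℕ => ((j : ℚ) * e * q - q - 1) ^ (i : ℕ) * (μ j : ℚ))]
    rfl
  rw [hM, ← hmul, Matrix.mulVec_mulVec, Matrix.nonsing_inv_mul _ hdet, Matrix.one_mulVec]
end
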